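/- Let f, g : (0,∞) → ℝ be continuous with compact support contained in (0,∞), and define Πf(x) = ∫₀^∞ f(λ)·ψ₁(λx) dλ for x > 0, and similarly Πg. Then Πf and Πg are square-integrable on (0,∞) and ∫₀^∞ Πf(x)·Πg(x) dx = (π/2)·∫₀^∞ f(λ)·g(λ) dλ (Plancherel theorem for the generalized eigenfunction expansion of the killed Cauchy semigroup on the half-line). -/

import Mathlib

open Real MeasureTheory Set

/-- `η t = (1/4)·log(1+t²) − (1/π)·∫₀^t log|s|/(1+s²) ds`. -/
noncomputable def etaF (t : ℝ) : ℝ :=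
  Real.log (1 + t ^ 2) / 4 - (1 / Real.pi) * ∫ s in (0 : ℝ)..t, Real.log |s| / (1 + s ^ 2)

/-- The remainder term `r`. -/
noncomputable def rfun (x : ℝ) : ℝ :=
  (Real.sqrt 2 / (2 * Real.pi)) *
    ∫ t in Ioi (0 : ℝ), (t / (1 + t ^ 2)) * Real.exp (-etaF t) * Real.exp (-t * x)

/-- The generalized eigenfunction `ψ₁`. -/
noncomputable def psiOne (x : ℝ) : ℝ :=
  if 0 < x then Real.sin (x + Real.pi / 8) - rfun x else 0

/-- `Πf(x) = ∫₀^∞ f(λ)·ψ₁(λx) dλ`. -/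
noncomputable def PiT (f : ℝ → ℝ) (x : ℝ) : ℝ :=
  ∫ l in Ioi (0 : ℝ), f l * psiOne (l * x)

open Filter Topology ComplexConjugate

/-! ### The real function `η` -/

theorem intervalIntegrable_log_abs_div (a b : ℝ) :
    IntervalIntegrable (fun s : ℝ => Real.log |s| / (1 + s ^ 2)) volume a b := by
  simp only [Real.log_abs, div_eq_mul_inv]
  refine intervalIntegral.intervalIntegrable_log'.mul_continuousOn ?_
  exact (Continuous.inv₀ (by fun_prop) fun s => by positivity).continuousOn

theorem continuous_etaF : Continuous etaF := by
  have h1 : Continuous fun t : ℝ => Real.log (1 + t ^ 2) :=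
    Continuous.log (by fun_prop) fun s => by positivity
  have h2 := intervalIntegral.continuous_primitive intervalIntegrable_log_abs_div 0
  unfold etaF
  fun_prop

theorem etaF_zero : etaF 0 = 0 := by simp [etaF]

theorem hasDerivAt_etaF {t : ℝ} (ht : 0 < t) :
    HasDerivAt etaF ((t / 2 - Real.log t / π) / (1 + t ^ 2)) t := by
  have h1 : HasDerivAt (fun t : ℝ => Real.log (1 + t ^ 2)) (2 * t / (1 + t ^ 2)) t := by
    have : HasDerivAt (fun t : ℝ => 1 + t ^ 2) (2 * t) t := by
      simpa using (hasDerivAt_pow 2 t).const_add 1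
    exact this.log (by positivity)
  have hc : ContinuousAt (fun s : ℝ => Real.log |s| / (1 + s ^ 2)) t := by
    simp only [Real.log_abs]
    exact (Real.continuousAt_log ht.ne').div (by fun_prop) (by positivity)
  have hm : StronglyMeasurableAtFilter (fun s : ℝ => Real.log |s| / (1 + s ^ 2)) (𝓝 t) volume := by
    refine ⟨univ, univ_mem, Measurable.aestronglyMeasurable ?_⟩
    exact (Real.measurable_log.comp (by fun_prop)).div (by fun_prop)
  have h2 := intervalIntegral.integral_hasDerivAt_right (intervalIntegrable_log_abs_div 0 t) hm hc
  have h3 := (h1.div_const 4).sub (h2.const_mul (1 / π))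
  convert! h3 using 1
  have := Real.pi_pos
  rw [Real.log_abs]
  field_simp
  ring

theorem hasDerivAt_etaF_exp (u : ℝ) :
    HasDerivAt (fun u : ℝ => etaF (Real.exp u))
      ((Real.exp u / 2 - u / π) / (1 + Real.exp u ^ 2) * Real.exp u) u := by
  have := (hasDerivAt_etaF (Real.exp_pos u)).comp u (Real.hasDerivAt_exp u)
  simpa [Function.comp_def] using this

theorem etaF_exp_sub_neg (u : ℝ) :
    etaF (Real.exp u) - etaF (Real.exp (-u)) = u / 2 := by
  have hd : ∀ x : ℝ, HasDerivAt
      (fun u : ℝ => etaF (Real.exp u) - etaF (Real.exp (-u)) - u / 2) 0 x := by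
    intro x
    have h1 := hasDerivAt_etaF_exp x
    have h2 := (hasDerivAt_etaF_exp (-x)).comp x (hasDerivAt_neg x)
    have h3 := (h1.sub h2).sub ((hasDerivAt_id x).div_const 2)
    convert! h3 using 1
    have hx := Real.exp_pos x
    have := Real.pi_pos
    rw [Real.exp_neg]
    field_simp
    ring
  have hc := is_const_of_deriv_eq_zero (fun x => (hd x).differentiableAt)
    (fun x => (hd x).deriv) u 0
  simp at hc
  linarith

theorem exists_abs_etaF_sub_le : ∃ M : ℝ, ∀ u : ℝ, |etaF (Real.exp u) - max u 0 / 2| ≤ M := by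
  obtain ⟨M, hM⟩ := (isCompact_Icc (a := (0 : ℝ)) (b := 1)).exists_bound_of_continuousOn
    continuous_etaF.continuousOn
  refine ⟨M, fun u => ?_⟩
  rcases le_total u 0 with h | h
  · rw [max_eq_right h]
    simpa using hM (Real.exp u) ⟨(Real.exp_pos u).le, by simpa using h⟩
  · rw [max_eq_left h]
    have h1 : etaF (Real.exp u) - u / 2 = etaF (Real.exp (-u)) := by
      linarith [etaF_exp_sub_neg u]
    rw [h1]
    simpa using hM (Real.exp (-u)) ⟨(Real.exp_pos _).le, by simpa using h⟩

/-! ### Holomorphic continuation of `u ↦ η (exp u)` to a strip -/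

/-- The open strip `-π/2 < Im w < 3π/2`. -/
def openStrip : Set ℂ := {w | -(π / 2) < w.im ∧ w.im < 3 * π / 2}

theorem isOpen_openStrip : IsOpen openStrip :=
  (isOpen_lt continuous_const Complex.continuous_im).inter
    (isOpen_lt Complex.continuous_im continuous_const)

theorem convex_openStrip : Convex ℝ openStrip :=
  (convex_halfSpace_im_gt (-(π / 2))).inter (convex_halfSpace_im_lt (3 * π / 2))

theorem mem_openStrip_of_mem_Icc {w : ℂ} (h0 : 0 ≤ w.im) (h1 : w.im ≤ π) : w ∈ openStrip :=
  ⟨by linarith [Real.pi_pos], by linarith [Real.pi_pos]⟩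

theorem ofReal_mem_openStrip (u : ℝ) : (u : ℂ) ∈ openStrip :=
  mem_openStrip_of_mem_Icc (by simp) (by simpa using Real.pi_pos.le)

/-- On the strip the exponential separates points. -/
theorem eq_of_exp_eq_of_mem_openStrip {w z : ℂ} (hw : w ∈ openStrip) (hz : z ∈ openStrip)
    (h : Complex.exp w = Complex.exp z) : w = z := by
  obtain ⟨n, hn⟩ := Complex.exp_eq_exp_iff_exists_int.1 h
  have him : w.im = z.im + n * (2 * π) := by simpa using congrArg Complex.im hn
  have hpi := Real.pi_pos
  have h1 : (n : ℝ) < 1 := by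
    by_contra! hc
    nlinarith [hw.2, hz.1]
  have h2 : (-1 : ℝ) < n := by
    by_contra! hc
    nlinarith [hw.1, hz.2]
  have : n = 0 := by
    have h1' : n < 1 := by exact_mod_cast h1
    have h2' : -1 < n := by exact_mod_cast h2
    omega
  simpa [this] using hn

theorem exp_pi_div_two_mul_I : Complex.exp ((π / 2 : ℝ) * Complex.I) = Complex.I := by
  rw [Complex.exp_mul_I]
  simp

theorem pi_div_two_mul_I_mem : ((π / 2 : ℝ) * Complex.I) ∈ openStrip :=
  mem_openStrip_of_mem_Icc (by simp; positivity) (by simp; linarith [Real.pi_pos])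

theorem exp_ne_neg_I_of_mem {w : ℂ} (hw : w ∈ openStrip) : Complex.exp w ≠ -Complex.I := by
  intro h
  have h1 : Complex.exp (((-(π / 2) : ℝ)) * Complex.I) = -Complex.I := by
    rw [Complex.exp_mul_I]
    simp
  obtain ⟨n, hn⟩ := Complex.exp_eq_exp_iff_exists_int.1 (h.trans h1.symm)
  have him : w.im = -(π / 2) + n * (2 * π) := by simpa using congrArg Complex.im hn
  have hpi := Real.pi_pos
  have h1 : (0 : ℝ) < n := by
    by_contra! hc
    nlinarith [hw.1]
  have h2 : (n : ℝ) < 1 := by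
    by_contra! hc
    nlinarith [hw.2]
  have h1' : 0 < n := by exact_mod_cast h1
  have h2' : n < 1 := by exact_mod_cast h2
  omega

theorem one_add_exp_two_mul_ne_zero {w : ℂ} (hw : w ∈ openStrip)
    (hne : w ≠ (π / 2 : ℝ) * Complex.I) : 1 + Complex.exp (2 * w) ≠ 0 := by
  intro h
  have h1 : (Complex.exp w - Complex.I) * (Complex.exp w + Complex.I) = 0 := by
    rw [two_mul, Complex.exp_add] at h
    linear_combination h - Complex.I_sq
  rcases mul_eq_zero.1 h1 with h2 | h2
  · exact hne (eq_of_exp_eq_of_mem_openStrip hw pi_div_two_mul_I_mem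
      (by rw [exp_pi_div_two_mul_I]; linear_combination h2))
  · exact exp_ne_neg_I_of_mem hw (by linear_combination h2)

theorem exists_etaDeriv : ∃ κ : ℂ → ℂ, DifferentiableOn ℂ κ openStrip ∧
    ∀ w ∈ openStrip, w ≠ (π / 2 : ℝ) * Complex.I →
      κ w = Complex.exp w * (Complex.exp w / 2 - w / π) / (1 + Complex.exp (2 * w)) := by
  set p : ℂ := (π / 2 : ℝ) * Complex.I with hp
  set N : ℂ → ℂ := fun w => Complex.exp w * (Complex.exp w / 2 - w / π) with hN
  set D : ℂ → ℂ := fun w => 1 + Complex.exp (2 * w) with hD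
  have hpi : (π : ℂ) ≠ 0 := by exact_mod_cast Real.pi_ne_zero
  have hexp : Complex.exp p = Complex.I := exp_pi_div_two_mul_I
  have hNp : N p = 0 := by
    simp only [hN, hexp]
    rw [hp]
    push_cast
    field_simp
    simp
  have hDp : D p = 0 := by
    simp only [hD]
    rw [two_mul, Complex.exp_add, hexp]
    simp
  have hnhds : openStrip ∈ 𝓝 p := isOpen_openStrip.mem_nhds pi_div_two_mul_I_mem
  have hNd : DifferentiableOn ℂ (dslope N p) openStrip :=
    (Complex.differentiableOn_dslope hnhds).2 (by fun_prop)
  have hDd : DifferentiableOn ℂ (dslope D p) openStrip :=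
    (Complex.differentiableOn_dslope hnhds).2 (by fun_prop)
  have hval : ∀ w ∈ openStrip, w ≠ p → dslope D p w ≠ 0 := by
    intro w hw hne
    rw [dslope_of_ne _ hne, slope_def_field, hDp, sub_zero]
    exact div_ne_zero (one_add_exp_two_mul_ne_zero hw hne) (sub_ne_zero.2 hne)
  have hDp' : dslope D p p ≠ 0 := by
    rw [dslope_same]
    have : HasDerivAt D (Complex.exp (2 * p) * 2) p := by
      have := ((hasDerivAt_id p).const_mul 2).cexp.const_add 1
      simpa [hD] using this
    rw [this.deriv]
    simp [Complex.exp_ne_zero]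
  refine ⟨fun w => dslope N p w / dslope D p w, hNd.div hDd fun w hw => ?_, fun w hw hne => ?_⟩
  · rcases eq_or_ne w p with rfl | hne
    · exact hDp'
    · exact hval w hw hne
  · have h0 : w - p ≠ 0 := sub_ne_zero.2 hne
    simp only [dslope_of_ne _ hne, slope_def_field, hDp, hNp, sub_zero]
    have := one_add_exp_two_mul_ne_zero hw hne
    simp only [hN, hD]
    field_simp

/-- The holomorphic extension of the derivative of `u ↦ η (exp u)` to the strip. -/
noncomputable def etaDeriv : ℂ → ℂ := Classical.choose exists_etaDeriv

theorem differentiableOn_etaDeriv : DifferentiableOn ℂ etaDeriv openStrip :=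
  (Classical.choose_spec exists_etaDeriv).1

theorem etaDeriv_eq {w : ℂ} (hw : w ∈ openStrip) (hne : w ≠ (π / 2 : ℝ) * Complex.I) :
    etaDeriv w = Complex.exp w * (Complex.exp w / 2 - w / π) / (1 + Complex.exp (2 * w)) :=
  (Classical.choose_spec exists_etaDeriv).2 w hw hne

theorem exists_etaExt : ∃ P : ℂ → ℂ, (∀ w ∈ openStrip, HasDerivAt P (etaDeriv w) w) ∧
    P 0 = etaF 1 := by
  obtain ⟨P, hP⟩ := convex_openStrip.exists_forall_hasDerivWithinAt differentiableOn_etaDeriv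
  refine ⟨fun w => P w + (etaF 1 - P 0), fun w hw => ?_, by ring⟩
  exact ((hP w hw).hasDerivAt (isOpen_openStrip.mem_nhds hw)).add_const _

/-- The holomorphic extension of `u ↦ η (exp u)` to the strip. -/
noncomputable def etaExt : ℂ → ℂ := Classical.choose exists_etaExt

theorem hasDerivAt_etaExt {w : ℂ} (hw : w ∈ openStrip) : HasDerivAt etaExt (etaDeriv w) w :=
  (Classical.choose_spec exists_etaExt).1 w hw

theorem etaExt_zero : etaExt 0 = etaF 1 := (Classical.choose_spec exists_etaExt).2

theorem etaDeriv_ofReal (u : ℝ) :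
    etaDeriv u =
      ((Real.exp u / 2 - u / π) / (1 + Real.exp u ^ 2) * Real.exp u : ℝ) := by
  rw [etaDeriv_eq (ofReal_mem_openStrip u)]
  · rw [two_mul, Complex.exp_add]
    push_cast
    ring
  · intro h
    have := congrArg Complex.im h
    simp at this
    linarith [Real.pi_pos]

theorem etaExt_ofReal (u : ℝ) : etaExt u = etaF (Real.exp u) := by
  have hd : ∀ x : ℝ, HasDerivAt
      (fun u : ℝ => etaExt u - (etaF (Real.exp u) : ℂ)) 0 x := by
    intro x
    have h1 := (hasDerivAt_etaExt (ofReal_mem_openStrip x)).comp_ofReal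
    have h2 := (hasDerivAt_etaF_exp x).ofReal_comp
    have h3 := h1.sub h2
    rw [etaDeriv_ofReal, sub_self] at h3
    exact h3
  have hc := is_const_of_deriv_eq_zero (fun x => (hd x).differentiableAt)
    (fun x => (hd x).deriv) u 0
  simp [etaExt_zero] at hc
  exact sub_eq_zero.1 hc

theorem norm_etaDeriv_le_of_le_neg_one {w : ℂ} (h0 : 0 ≤ w.im) (h1 : w.im ≤ π)
    (hre : w.re ≤ -1) : ‖etaDeriv w‖ ≤ 7 * Real.exp (w.re / 2) := by
  have hpi := Real.pi_gt_three
  have hne : w ≠ (π / 2 : ℝ) * Complex.I := by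
    rintro rfl
    simp at hre
    linarith
  set u := w.re with hu
  have hw : ‖w‖ ≤ -u + π := by
    refine (Complex.norm_le_abs_re_add_abs_im w).trans ?_
    rw [abs_of_nonneg h0, ← hu, abs_of_nonpos (by linarith)]
    linarith
  have hE : Real.exp u = Real.exp (u / 2) * Real.exp (u / 2) := by
    rw [← Real.exp_add]; ring_nf
  have hq : Real.exp (u / 2) * Real.exp (-(u / 2)) = 1 := by
    rw [← Real.exp_add]; simp
  have hq' : -(u / 2) + 1 ≤ Real.exp (-(u / 2)) := Real.add_one_le_exp _
  have hpos := Real.exp_pos (u / 2)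
  have hone : Real.exp (u / 2) ≤ 1 := by
    rw [Real.exp_le_one_iff]; linarith
  have hnum : ‖Complex.exp w / 2 - w / π‖ ≤ Real.exp u / 2 + (-u + π) / π := by
    refine (norm_sub_le _ _).trans ?_
    have : ‖(π : ℂ)‖ = π := by simp [abs_of_pos Real.pi_pos]
    rw [norm_div, norm_div, Complex.norm_exp, this]
    gcongr
    simp
  have hden : 1 / 2 ≤ ‖1 + Complex.exp (2 * w)‖ := by
    have h2 : ‖Complex.exp (2 * w)‖ ≤ 1 / 2 := by
      rw [Complex.norm_exp]
      have : (2 * w).re = 2 * u := by simp [hu]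
      rw [this]
      have h4 : (2 : ℝ) ≤ Real.exp (-(2 * u)) := by
        linarith [Real.add_one_le_exp (-(2 * u))]
      have h5 : Real.exp (2 * u) * Real.exp (-(2 * u)) = 1 := by
        rw [← Real.exp_add]; simp
      nlinarith [Real.exp_pos (2 * u)]
    have h3 := norm_sub_norm_le (1 : ℂ) (-Complex.exp (2 * w))
    rw [norm_neg, sub_neg_eq_add, norm_one] at h3
    linarith
  rw [etaDeriv_eq (mem_openStrip_of_mem_Icc h0 h1) hne, norm_div, norm_mul, Complex.norm_exp,
    ← hu, div_le_iff₀ (by linarith)]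
  have hX : (-u + π) / π ≤ -u + 1 := by
    rw [div_le_iff₀ (by linarith)]
    nlinarith
  have h6 : Real.exp u * ‖Complex.exp w / 2 - w / π‖
      ≤ Real.exp u * (Real.exp u / 2 + (-u + 1)) := by
    gcongr
    linarith
  have h7 : Real.exp (u / 2) * (-u + 1) ≤ 2 := by nlinarith
  have h8 : Real.exp u * (Real.exp u / 2 + (-u + 1)) ≤ 7 * Real.exp (u / 2) * (1 / 2) := by
    have : Real.exp u ≤ 1 := by rw [Real.exp_le_one_iff]; linarith
    have h9 : Real.exp u * (Real.exp u / 2 + (-u + 1)) = Real.exp (u / 2) *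
      (Real.exp (u / 2) * (Real.exp u / 2) + Real.exp (u / 2) * (-u + 1)) := by
      rw [hE]; ring
    rw [h9]
    have h10 : Real.exp (u / 2) * (Real.exp u / 2) ≤ 1 * (1 / 2) := by gcongr
    nlinarith
  calc _ ≤ _ := h6
    _ ≤ _ := h8
    _ ≤ _ := by gcongr

theorem norm_etaDeriv_le_of_one_le {w : ℂ} (h0 : 0 ≤ w.im) (h1 : w.im ≤ π)
    (hre : 1 ≤ w.re) : ‖etaDeriv w‖ ≤ 5 := by
  have hpi := Real.pi_gt_three
  have hne : w ≠ (π / 2 : ℝ) * Complex.I := by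
    rintro rfl
    simp at hre
    linarith
  set u := w.re with hu
  have hw : ‖w‖ ≤ u + π := by
    refine (Complex.norm_le_abs_re_add_abs_im w).trans ?_
    rw [abs_of_nonneg h0, ← hu, abs_of_nonneg (by linarith)]
    linarith
  have hpos := Real.exp_pos u
  have hq' : u + 1 ≤ Real.exp u := Real.add_one_le_exp _
  have hnum : ‖Complex.exp w / 2 - w / π‖ ≤ Real.exp u / 2 + (u + π) / π := by
    refine (norm_sub_le _ _).trans ?_
    have : ‖(π : ℂ)‖ = π := by simp [abs_of_pos Real.pi_pos]
    rw [norm_div, norm_div, Complex.norm_exp, this]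
    gcongr
    simp
  have hden : Real.exp u * Real.exp u / 2 ≤ ‖1 + Complex.exp (2 * w)‖ := by
    have h2 : ‖Complex.exp (2 * w)‖ = Real.exp u * Real.exp u := by
      rw [Complex.norm_exp, ← Real.exp_add]
      congr 1
      simp [hu]
      ring
    have h3 := norm_sub_norm_le (Complex.exp (2 * w)) (-1)
    rw [norm_neg, sub_neg_eq_add, norm_one, h2, add_comm] at h3
    nlinarith
  have hX : (u + π) / π ≤ u + 1 := by
    rw [div_le_iff₀ (by linarith)]
    nlinarith
  rw [etaDeriv_eq (mem_openStrip_of_mem_Icc h0 h1) hne, norm_div, norm_mul, Complex.norm_exp,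
    ← hu, div_le_iff₀ (by nlinarith)]
  have h6 : Real.exp u * ‖Complex.exp w / 2 - w / π‖
      ≤ Real.exp u * (Real.exp u / 2 + Real.exp u) := by
    gcongr
    linarith
  nlinarith

theorem exists_norm_etaDeriv_le : ∃ M : ℝ, 0 ≤ M ∧ ∀ w : ℂ, 0 ≤ w.im → w.im ≤ π →
    ‖etaDeriv w‖ ≤ M := by
  have hK : IsCompact (Icc (-1 : ℝ) 1 ×ℂ Icc 0 π) := isCompact_Icc.reProdIm isCompact_Icc
  obtain ⟨M, hM⟩ := hK.exists_bound_of_continuousOn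
    (differentiableOn_etaDeriv.continuousOn.mono fun w hw =>
      mem_openStrip_of_mem_Icc hw.2.1 hw.2.2)
  refine ⟨max M 7, by positivity, fun w h0 h1 => ?_⟩
  rcases le_total w.re (-1) with h | h
  · have := norm_etaDeriv_le_of_le_neg_one h0 h1 h
    have h2 : Real.exp (w.re / 2) ≤ 1 := by rw [Real.exp_le_one_iff]; linarith
    exact le_max_of_le_right (by linarith)
  · rcases le_total w.re 1 with h' | h'
    · exact le_max_of_le_left (hM w ⟨⟨h, h'⟩, ⟨h0, h1⟩⟩)
    · exact le_max_of_le_right (by linarith [norm_etaDeriv_le_of_one_le h0 h1 h'])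

theorem norm_etaExt_sub_le {w : ℂ} (h0 : 0 ≤ w.im) (h1 : w.im ≤ π) {C : ℝ}
    (hC : ∀ z : ℂ, z.re = w.re → 0 ≤ z.im → z.im ≤ π → ‖etaDeriv z‖ ≤ C) :
    ‖etaExt w - etaExt (w.re : ℂ)‖ ≤ C * π := by
  have hC0 : 0 ≤ C := (norm_nonneg _).trans (hC w rfl h0 h1)
  have hconv : Convex ℝ ({z : ℂ | z.re = w.re} ∩ {z : ℂ | 0 ≤ z.im} ∩ {z : ℂ | z.im ≤ π}) :=
    ((convex_hyperplane Complex.reCLM.toLinearMap.isLinear w.re).inter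
      (convex_halfSpace_im_ge 0)).inter (convex_halfSpace_im_le π)
  have := hconv.norm_image_sub_le_of_norm_hasDerivWithin_le (f := etaExt) (f' := etaDeriv)
    (x := (w.re : ℂ)) (y := w) (C := C)
    (fun z hz => (hasDerivAt_etaExt (mem_openStrip_of_mem_Icc hz.1.2 hz.2)).hasDerivWithinAt)
    (fun z hz => hC z hz.1.1 hz.1.2 hz.2) (by simp [Real.pi_pos.le]) (by simp [h0, h1])
  refine this.trans ?_
  gcongr
  have h2 : w - (w.re : ℂ) = w.im * Complex.I := by
    apply Complex.ext <;> simp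
  rw [h2]
  simpa [abs_of_nonneg h0] using h1

theorem exists_abs_re_etaExt_sub_le : ∃ M : ℝ, ∀ w : ℂ, 0 ≤ w.im → w.im ≤ π →
    |(etaExt w).re - max w.re 0 / 2| ≤ M := by
  obtain ⟨M, -, hM⟩ := exists_norm_etaDeriv_le
  obtain ⟨M', hM'⟩ := exists_abs_etaF_sub_le
  refine ⟨M * π + M', fun w h0 h1 => ?_⟩
  have h2 := norm_etaExt_sub_le h0 h1 fun z _ hz0 hz1 => hM z hz0 hz1
  have h3 := (Complex.abs_re_le_norm _).trans h2
  rw [etaExt_ofReal, Complex.sub_re, Complex.ofReal_re] at h3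
  calc _ = |((etaExt w).re - etaF (Real.exp w.re)) +
        (etaF (Real.exp w.re) - max w.re 0 / 2)| := by ring_nf
    _ ≤ _ := (abs_add_le _ _).trans (add_le_add h3 (hM' _))

theorem tendsto_etaExt_ofReal_atBot : Tendsto (fun u : ℝ => etaExt u) atBot (𝓝 0) := by
  simp only [etaExt_ofReal]
  have h1 : Tendsto (fun u : ℝ => etaF (Real.exp u)) atBot (𝓝 0) := by
    have := (continuous_etaF.tendsto 0).comp Real.tendsto_exp_atBot
    rwa [etaF_zero] at this
  exact_mod_cast (Complex.continuous_ofReal.tendsto 0).comp h1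

theorem tendsto_etaExt_add_pi_mul_I_atBot :
    Tendsto (fun u : ℝ => etaExt (u + π * Complex.I)) atBot (𝓝 0) := by
  have h1 : Tendsto (fun u : ℝ => etaExt (u + π * Complex.I) - etaExt u) atBot (𝓝 0) := by
    have h2 : Tendsto (fun u : ℝ => 7 * Real.exp (u / 2) * π) atBot (𝓝 0) := by
      have : Tendsto (fun u : ℝ => Real.exp (u / 2)) atBot (𝓝 0) :=
        Real.tendsto_exp_atBot.comp (tendsto_id.atBot_div_const (by norm_num))
      simpa using (this.const_mul 7).mul_const π
    refine squeeze_zero_norm' ?_ h2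
    filter_upwards [eventually_le_atBot (-1)] with u hu
    have := norm_etaExt_sub_le (w := u + π * Complex.I) (by simp [Real.pi_pos.le]) (by simp)
      (C := 7 * Real.exp (u / 2)) ?_
    · simpa using this
    · intro z hz h0 h1
      simp at hz
      have := norm_etaDeriv_le_of_le_neg_one h0 h1 (by rw [hz]; exact hu)
      rwa [hz] at this
  simpa using h1.add tendsto_etaExt_ofReal_atBot

/-- Reflection of the strip in the line `Im w = π/2`. -/
theorem conj_add_pi_mul_I_mem {w : ℂ} (hw : w ∈ openStrip) :
    conj w + π * Complex.I ∈ openStrip := by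
  constructor
  · simp; linarith [hw.2]
  · simp; linarith [hw.1]

theorem one_sub_I_mul_exp_ne_zero {w : ℂ} (hw : w ∈ openStrip) :
    1 - Complex.I * Complex.exp w ≠ 0 := by
  intro h
  apply exp_ne_neg_I_of_mem hw
  linear_combination Complex.I * h + Complex.exp w * Complex.I_sq

theorem etaDeriv_add_conj {w : ℂ} (hw : w ∈ openStrip) :
    etaDeriv w + conj (etaDeriv (conj w + π * Complex.I)) =
      -(Complex.I * Complex.exp w) / (1 - Complex.I * Complex.exp w) := by
  have key : ∀ z ∈ openStrip, z ≠ (π / 2 : ℝ) * Complex.I →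
      etaDeriv z + conj (etaDeriv (conj z + π * Complex.I)) =
      -(Complex.I * Complex.exp z) / (1 - Complex.I * Complex.exp z) := by
    intro z hz hne
    have hne' : conj z + π * Complex.I ≠ (π / 2 : ℝ) * Complex.I := by
      intro h
      apply hne
      have h2 := congrArg conj h
      simp only [map_add, map_mul, Complex.conj_conj, Complex.conj_ofReal, Complex.conj_I] at h2
      push_cast at h2 ⊢
      linear_combination h2
    have hd := one_add_exp_two_mul_ne_zero hz hne
    have hd2 := one_sub_I_mul_exp_ne_zero hz
    rw [etaDeriv_eq hz hne, etaDeriv_eq (conj_add_pi_mul_I_mem hz) hne']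
    have hpi : (π : ℂ) ≠ 0 := by exact_mod_cast Real.pi_ne_zero
    have e1 : Complex.exp (conj z + π * Complex.I) = -conj (Complex.exp z) := by
      rw [Complex.exp_add, Complex.exp_pi_mul_I, ← Complex.exp_conj]
      ring
    have e2 : Complex.exp (2 * (conj z + π * Complex.I)) = conj (Complex.exp (2 * z)) := by
      rw [two_mul, Complex.exp_add, e1, two_mul, Complex.exp_add]
      simp
    rw [e1, e2]
    simp only [map_div₀, map_mul, map_neg, map_sub, map_add, Complex.conj_conj, Complex.conj_I,
      Complex.conj_ofReal, map_one, map_ofNat]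
    rw [two_mul, Complex.exp_add, ← pow_two] at hd ⊢
    generalize Complex.exp z = e at hd hd2 ⊢
    rw [mul_comm] at hd2
    field_simp
    linear_combination (2 * π * e ^ 2) * Complex.I_sq
  rcases eq_or_ne w ((π / 2 : ℝ) * Complex.I) with h | h
  · have hU := isOpen_openStrip.mem_nhds hw
    have hU' := isOpen_openStrip.mem_nhds (conj_add_pi_mul_I_mem hw)
    have c1 : ContinuousAt etaDeriv w := (differentiableOn_etaDeriv.differentiableAt hU).continuousAt
    have c2 : ContinuousAt etaDeriv (conj w + π * Complex.I) :=
      (differentiableOn_etaDeriv.differentiableAt hU').continuousAt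
    have c3 : ContinuousAt (fun z => conj (etaDeriv (conj z + π * Complex.I))) w := by
      refine Complex.continuous_conj.continuousAt.comp ?_
      exact ContinuousAt.comp (f := fun z : ℂ => conj z + π * Complex.I) c2
        (by fun_prop)
    have c4 : ContinuousAt (fun z => -(Complex.I * Complex.exp z) / (1 - Complex.I * Complex.exp z))
        w := ContinuousAt.div (by fun_prop) (by fun_prop) (one_sub_I_mul_exp_ne_zero hw)
    refine tendsto_nhds_unique_of_eventuallyEq (l := 𝓝[≠] w)
      ((c1.add c3).tendsto.mono_left nhdsWithin_le_nhds) (c4.tendsto.mono_left nhdsWithin_le_nhds) ?_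
    filter_upwards [nhdsWithin_le_nhds hU, self_mem_nhdsWithin] with z hz hne
    exact key z hz (by rw [← h]; exact hne)
  · exact key w hw h

theorem exp_etaExt_mul_conj {w : ℂ} (hw : w ∈ openStrip) :
    Complex.exp (etaExt w) * conj (Complex.exp (etaExt (conj w + π * Complex.I))) =
      1 - Complex.I * Complex.exp w := by
  set R : ℂ → ℂ := fun w => Complex.exp (etaExt w + conj (etaExt (conj w + π * Complex.I))) /
    (1 - Complex.I * Complex.exp w) with hR
  have hd : ∀ z ∈ openStrip, HasDerivAt R 0 z := by
    intro z hz
    have h1 := hasDerivAt_etaExt hz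
    have h2 : HasDerivAt (fun z => etaExt (z + π * Complex.I))
        (etaDeriv (conj z + π * Complex.I)) (conj z) := by
      have := (hasDerivAt_etaExt (conj_add_pi_mul_I_mem hz)).comp (conj z)
        ((hasDerivAt_id (conj z)).add_const (π * Complex.I))
      simpa [Function.comp_def] using this
    have h3 := h2.conj_conj
    rw [Complex.conj_conj] at h3
    have h4 := (h1.add h3).cexp
    have h5 := (((Complex.hasDerivAt_exp z).const_mul Complex.I).const_sub 1)
    have h6 := h4.div h5 (one_sub_I_mul_exp_ne_zero hz)
    convert! h6 using 1
    have hne := one_sub_I_mul_exp_ne_zero hz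
    simp only [Pi.add_apply]
    rw [etaDeriv_add_conj hz]
    field_simp
    ring
  have hconst : ∀ z ∈ openStrip, R z = R w := fun z hz =>
    isOpen_openStrip.is_const_of_deriv_eq_zero convex_openStrip.isPreconnected
      (fun y hy => (hd y hy).differentiableAt.differentiableWithinAt)
      (fun y hy => (hd y hy).deriv) hz hw
  have hlim : Tendsto (fun u : ℝ => R u) atBot (𝓝 1) := by
    have h1 : Tendsto (fun u : ℝ => Complex.exp (u : ℂ)) atBot (𝓝 0) := by
      simp only [← Complex.ofReal_exp]
      exact_mod_cast (Complex.continuous_ofReal.tendsto 0).comp Real.tendsto_exp_atBot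
    have h2 : Tendsto (fun u : ℝ => conj (etaExt (u + π * Complex.I))) atBot (𝓝 0) := by
      have := (Complex.continuous_conj.tendsto 0).comp tendsto_etaExt_add_pi_mul_I_atBot
      simpa [Function.comp_def] using this
    have h3 := (Complex.continuous_exp.tendsto 0).comp
      (by simpa using tendsto_etaExt_ofReal_atBot.add h2)
    have h4 : Tendsto (fun u : ℝ => 1 - Complex.I * Complex.exp (u : ℂ)) atBot (𝓝 1) := by
      simpa using (h1.const_mul Complex.I).const_sub 1
    have h5 := h3.div h4 one_ne_zero
    simpa [hR, Function.comp_def, Pi.div_def] using h5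
  have hone : R w = 1 := by
    refine tendsto_nhds_unique (tendsto_const_nhds.congr fun u => ?_) hlim
    exact (hconst u (ofReal_mem_openStrip u)).symm
  rw [hR] at hone
  simp only at hone
  rw [div_eq_one_iff_eq (one_sub_I_mul_exp_ne_zero hw)] at hone
  rw [← hone, ← Complex.exp_conj, ← Complex.exp_add]

theorem exp_etaExt_add_pi_mul_I (u : ℝ) :
    Complex.exp (etaExt (u + π * Complex.I)) =
      (1 + Complex.I * Real.exp u) / Real.exp (etaF (Real.exp u)) := by
  have h := congrArg conj (exp_etaExt_mul_conj (ofReal_mem_openStrip u))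
  simp only [map_mul, Complex.conj_conj, map_sub, map_one, Complex.conj_I, Complex.conj_ofReal,
    ← Complex.exp_conj, etaExt_ofReal] at h
  rw [eq_div_iff (by exact_mod_cast (Real.exp_pos _).ne')]
  push_cast
  linear_combination h

theorem im_etaExt_mul_I {v : ℝ} (h0 : 0 ≤ v) (h1 : v < π / 2) : (etaExt (v * Complex.I)).im = v / 4 := by
  have hd : ∀ y ∈ Ico 0 (π / 2), HasDerivAt
      (fun v : ℝ => (etaExt (v * Complex.I)).im - v / 4) 0 y := by
    intro y hy
    have hmem : (y : ℂ) * Complex.I ∈ openStrip :=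
      mem_openStrip_of_mem_Icc (by simpa using hy.1) (by simp; linarith [hy.2, Real.pi_pos])
    have h2 : HasDerivAt (fun v : ℂ => etaExt (v * Complex.I))
        (etaDeriv (y * Complex.I) * Complex.I) (y : ℂ) := by
      have := (hasDerivAt_etaExt hmem).comp (y : ℂ) ((hasDerivAt_id (y : ℂ)).mul_const Complex.I)
      simpa [Function.comp_def] using this
    have h3 := (Complex.imCLM.hasFDerivAt.comp_hasDerivAt y h2.comp_ofReal)
    have h4 := h3.sub ((hasDerivAt_id y).div_const 4)
    convert! h4 using 1
    have hne : (y : ℂ) * Complex.I ≠ (π / 2 : ℝ) * Complex.I := by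
      intro h
      have := mul_right_cancel₀ Complex.I_ne_zero h
      have : y = π / 2 := by exact_mod_cast this
      linarith [hy.2]
    have hc : 0 < Real.cos y := Real.cos_pos_of_mem_Ioo ⟨by linarith [hy.1, Real.pi_pos], hy.2⟩
    have hc' : (Complex.cos y) ≠ 0 := by
      rw [← Complex.ofReal_cos]
      exact_mod_cast hc.ne'
    have hform : etaDeriv (y * Complex.I) =
        ((1 / 4 : ℝ) : ℂ) + ((Real.sin y / (4 * Real.cos y) - y / (2 * π * Real.cos y) : ℝ) : ℂ)
          * Complex.I := by
      rw [etaDeriv_eq hmem hne]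
      have hden := one_add_exp_two_mul_ne_zero hmem hne
      have hpi : (π : ℂ) ≠ 0 := by exact_mod_cast Real.pi_ne_zero
      have hexp : Complex.exp (y * Complex.I) ≠ 0 := Complex.exp_ne_zero _
      have h2c : 1 + Complex.exp (2 * (y * Complex.I)) =
          2 * Complex.cos y * Complex.exp (y * Complex.I) := by
        rw [Complex.two_cos, two_mul, Complex.exp_add, add_mul, ← Complex.exp_add,
          ← Complex.exp_add]
        simp
        ring
      rw [h2c]
      push_cast
      rw [mul_comm (2 * Complex.cos y), mul_div_mul_left _ _ hexp, Complex.exp_mul_I]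
      field_simp
      ring
    rw [hform]
    generalize Real.sin y / (4 * Real.cos y) - y / (2 * π * Real.cos y) = b
    simp
  have hc := constant_of_has_deriv_right_zero (a := 0) (b := v)
    (f := fun v : ℝ => (etaExt (v * Complex.I)).im - v / 4)
    (fun y hy => (hd y ⟨hy.1, hy.2.trans_lt h1⟩).continuousAt.continuousWithinAt)
    (fun y hy => (hd y ⟨hy.1, hy.2.trans h1⟩).hasDerivWithinAt) v ⟨h0, le_rfl⟩
  simp [etaExt_zero] at hc
  linarith

theorem im_etaExt_pi_div_two_mul_I : (etaExt ((π / 2 : ℝ) * Complex.I)).im = π / 8 := by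
  have hc : ContinuousAt (fun v : ℝ => (etaExt (v * Complex.I)).im) (π / 2) := by
    refine Complex.continuous_im.continuousAt.comp ?_
    exact ContinuousAt.comp (f := fun v : ℝ => (v : ℂ) * Complex.I)
      (hasDerivAt_etaExt pi_div_two_mul_I_mem).continuousAt (by fun_prop)
  have h1 := hc.tendsto.mono_left (nhdsWithin_le_nhds (s := Iio (π / 2)))
  have h2 : Tendsto (fun v : ℝ => v / 4) (𝓝[<] (π / 2)) (𝓝 (π / 2 / 4)) :=
    (continuous_id.div_const 4).continuousAt.tendsto.mono_left nhdsWithin_le_nhds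
  have h3 := tendsto_nhds_unique_of_eventuallyEq h1 h2 ?_
  · rw [h3]; ring
  · filter_upwards [Ioo_mem_nhdsLT (show (0 : ℝ) < π / 2 by positivity)] with v hv
    exact im_etaExt_mul_I hv.1.le hv.2

theorem exp_etaExt_pi_div_two_mul_I :
    Complex.exp (etaExt ((π / 2 : ℝ) * Complex.I)) =
      Real.sqrt 2 * Complex.exp ((π / 8 : ℝ) * Complex.I) := by
  have h := exp_etaExt_mul_conj pi_div_two_mul_I_mem
  have e1 : conj (((π / 2 : ℝ) : ℂ) * Complex.I) + π * Complex.I = (π / 2 : ℝ) * Complex.I := by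
    simp only [map_mul, Complex.conj_ofReal, Complex.conj_I]
    push_cast
    ring
  rw [e1, exp_pi_div_two_mul_I, Complex.mul_conj, Complex.normSq_eq_norm_sq,
    Complex.I_mul_I, Complex.norm_exp] at h
  have h2 : Real.exp (etaExt ((π / 2 : ℝ) * Complex.I)).re ^ 2 = 2 := by
    have : ((Real.exp (etaExt ((π / 2 : ℝ) * Complex.I)).re ^ 2 : ℝ) : ℂ) = (2 : ℝ) := by
      rw [h]; norm_num
    exact_mod_cast this
  have h3 : Real.sqrt 2 = Real.exp (etaExt ((π / 2 : ℝ) * Complex.I)).re := by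
    have h3 := Real.sqrt_sq (Real.exp_pos (etaExt ((π / 2 : ℝ) * Complex.I)).re).le
    rwa [h2] at h3
  conv_lhs => rw [← Complex.re_add_im (etaExt _), Complex.exp_add, im_etaExt_pi_div_two_mul_I]
  rw [h3, Complex.ofReal_exp]

theorem integrable_exp_neg_abs_div_two : Integrable (fun u : ℝ => Real.exp (-(|u| / 2))) := by
  rw [← integrableOn_univ, ← Iic_union_Ioi (a := (0 : ℝ))]
  refine IntegrableOn.union ?_ ?_
  · refine (integrableOn_exp_mul_Iic (a := 1 / 2) (by norm_num) 0).congr_fun ?_ measurableSet_Iic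
    intro u hu
    simp only [abs_of_nonpos (mem_Iic.mp hu)]
    ring_nf
  · refine (integrableOn_exp_mul_Ioi (a := -1 / 2) (by norm_num) 0).congr_fun ?_ measurableSet_Ioi
    intro u hu
    simp only [abs_of_pos (mem_Ioi.mp hu)]
    ring_nf

/-- A function that is continuous on the closed strip and has exponential tails decays
exponentially on the whole strip. -/
theorem exists_norm_le_exp_neg_abs {U : Set ℂ} {f : ℂ → ℂ} {R K : ℝ}
    (hcU : ∀ w : ℂ, 0 ≤ w.im → w.im ≤ π → w ∈ U) (hf : ContinuousOn f U)
    (hK : ∀ w : ℂ, 0 ≤ w.im → w.im ≤ π → R ≤ |w.re| → ‖f w‖ ≤ K * Real.exp (-(|w.re| / 2))) :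
    ∃ K', 0 ≤ K' ∧ ∀ w : ℂ, 0 ≤ w.im → w.im ≤ π → ‖f w‖ ≤ K' * Real.exp (-(|w.re| / 2)) := by
  have hcomp : IsCompact (Icc (-R) R ×ℂ Icc 0 π) := isCompact_Icc.reProdIm isCompact_Icc
  obtain ⟨B, hB⟩ := hcomp.exists_bound_of_continuousOn (f := f) (hf.mono fun w hw =>
    hcU w hw.2.1 hw.2.2)
  refine ⟨max K (|B| * Real.exp (|R| / 2)) ⊔ 0, le_max_right _ _, fun w h0 h1 => ?_⟩
  have hE := Real.exp_pos (-(|w.re| / 2))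
  rcases le_total R |w.re| with h | h
  · refine (hK w h0 h1 h).trans ?_
    gcongr
    exact (le_max_left _ _).trans (le_max_left _ _)
  · have h2 := hB w ⟨abs_le.mp h, h0, h1⟩
    calc ‖f w‖ ≤ |B| := h2.trans (le_abs_self _)
      _ ≤ |B| * (Real.exp (|R| / 2) * Real.exp (-(|w.re| / 2))) := by
        rw [← Real.exp_add]
        refine le_mul_of_one_le_right (abs_nonneg _) (Real.one_le_exp ?_)
        have := le_abs_self R
        linarith
      _ = |B| * Real.exp (|R| / 2) * Real.exp (-(|w.re| / 2)) := by ring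
      _ ≤ _ := by
        gcongr
        exact (le_max_right _ _).trans (le_max_left _ _)

theorem integrable_of_norm_le_exp_neg_abs {U : Set ℂ} {f : ℂ → ℂ} {K v : ℝ}
    (hcU : ∀ w : ℂ, 0 ≤ w.im → w.im ≤ π → w ∈ U) (hf : ContinuousOn f U)
    (hv0 : 0 ≤ v) (hv1 : v ≤ π)
    (hK : ∀ w : ℂ, 0 ≤ w.im → w.im ≤ π → ‖f w‖ ≤ K * Real.exp (-(|w.re| / 2))) :
    Integrable (fun u : ℝ => f (u + v * Complex.I)) := by
  refine (integrable_exp_neg_abs_div_two.const_mul K).mono' ?_ ?_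
  · refine Continuous.aestronglyMeasurable ?_
    refine hf.comp_continuous (by fun_prop) fun u => ?_
    exact hcU _ (by simpa using hv0) (by simpa using hv1)
  · refine Eventually.of_forall fun u => ?_
    simpa using hK (u + v * Complex.I) (by simpa using hv0) (by simpa using hv1)

theorem integral_eq_integral_add_pi_mul_I {U : Set ℂ} {f : ℂ → ℂ} {K : ℝ}
    (hcU : ∀ w : ℂ, 0 ≤ w.im → w.im ≤ π → w ∈ U) (hf : DifferentiableOn ℂ f U)
    (hK : ∀ w : ℂ, 0 ≤ w.im → w.im ≤ π → ‖f w‖ ≤ K * Real.exp (-(|w.re| / 2))) :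
    ∫ u : ℝ, f u = ∫ u : ℝ, f (u + π * Complex.I) := by
  have hpi := Real.pi_pos
  have i0 : Integrable (fun u : ℝ => f u) := by
    simpa using integrable_of_norm_le_exp_neg_abs (v := 0) hcU hf.continuousOn le_rfl hpi.le hK
  have i1 : Integrable (fun u : ℝ => f (u + π * Complex.I)) :=
    integrable_of_norm_le_exp_neg_abs hcU hf.continuousOn hpi.le le_rfl hK
  have t0 := intervalIntegral_tendsto_integral i0 tendsto_neg_atTop_atBot tendsto_id
  have t1 := intervalIntegral_tendsto_integral i1 tendsto_neg_atTop_atBot tendsto_id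
  have side : ∀ s : ℝ → ℝ, (∀ T, |s T| = |T|) →
      Tendsto (fun T : ℝ => Complex.I • ∫ y in (0 : ℝ)..π, f (s T + y * Complex.I)) atTop (𝓝 0) := by
    intro s hs
    rw [tendsto_zero_iff_norm_tendsto_zero]
    have h0 : Tendsto (fun T : ℝ => K * Real.exp (-(T / 2)) * |π - 0|) atTop (𝓝 0) := by
      have : Tendsto (fun T : ℝ => Real.exp (-(T / 2))) atTop (𝓝 0) :=
        Real.tendsto_exp_neg_atTop_nhds_zero.comp (tendsto_id.atTop_div_const (by norm_num))
      simpa using (this.const_mul K).mul_const |π - 0|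
    refine squeeze_zero' (Eventually.of_forall fun _ => norm_nonneg _) ?_ h0
    filter_upwards [eventually_ge_atTop 0] with T hT
    rw [norm_smul, Complex.norm_I, one_mul]
    refine intervalIntegral.norm_integral_le_of_norm_le_const fun y hy => ?_
    rw [uIoc_of_le hpi.le] at hy
    have := hK (s T + y * Complex.I) (by simpa using hy.1.le) (by simpa using hy.2)
    simpa [hs, abs_of_nonneg hT] using this
  have sR := side id fun _ => rfl
  have sL := side (fun T => -T) fun _ => abs_neg _
  have key := ((t0.sub t1).add sR).sub sL
  have key2 := tendsto_nhds_unique key (tendsto_const_nhds.congr fun T => ?_) (b := 0)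
  · simp only [add_zero, sub_zero] at key2
    exact sub_eq_zero.mp key2
  · have h2 := Complex.integral_boundary_rect_eq_zero_of_differentiableOn f
      ((-T : ℝ) : ℂ) (T + π * Complex.I) (hf.mono fun w hw => by
        have := hw.2
        simp [uIcc_of_le hpi.le] at this
        exact hcU w this.1 this.2)
    simp at h2
    simp
    rw [← h2]

theorem integral_inv_add_I_mul_inv_sub {p : ℂ} (hp : 0 < p.im) :
    Integrable (fun t : ℝ => ((t + Complex.I) * (t - p) : ℂ)⁻¹) ∧
    ∫ t : ℝ, ((t + Complex.I) * (t - p) : ℂ)⁻¹ = 2 * π * Complex.I / (p + Complex.I) := by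
  have hne : ∀ t : ℝ, (t : ℂ) - p ≠ 0 := fun t h => by
    have := congrArg Complex.im h
    simp at this
    exact hp.ne' this
  have hne' : ∀ t : ℝ, (t : ℂ) + Complex.I ≠ 0 := fun t h => by
    have := congrArg Complex.im h
    simp at this
  have hpI : p + Complex.I ≠ 0 := fun h => by
    have := congrArg Complex.im h
    simp at this
    linarith
  have hint : Integrable (fun t : ℝ => ((t + Complex.I) * (t - p) : ℂ)⁻¹) := by
    have hcont : Continuous (fun t : ℝ => ((t + Complex.I) * (t - p) : ℂ)⁻¹) :=
      Continuous.inv₀ (by fun_prop) fun t => mul_ne_zero (hne' t) (hne t)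
    have hcont2 : Continuous (fun t : ℝ => ((t + Complex.I) / (t - p) : ℂ)) :=
      Continuous.div (by fun_prop) (by fun_prop) hne
    have hbd : ∃ K, ∀ t : ℝ, ‖((t + Complex.I) / (t - p) : ℂ)‖ ≤ K := by
      refine ⟨1 + ‖p + Complex.I‖ / p.im, fun t => ?_⟩
      have e : ((t + Complex.I) / (t - p) : ℂ) = 1 + (p + Complex.I) / (t - p) := by
        field_simp [hne t]
        ring
      rw [e]
      refine (norm_add_le _ _).trans ?_
      rw [norm_one, norm_div]
      gcongr
      have := Complex.abs_im_le_norm (t - p)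
      simpa [abs_of_pos hp] using this
    obtain ⟨K, hK⟩ := hbd
    refine (integrable_inv_one_add_sq.const_mul K).mono' hcont.aestronglyMeasurable ?_
    refine Eventually.of_forall fun t => ?_
    have e : ((t + Complex.I) * (t - p) : ℂ)⁻¹ =
        (t + Complex.I) / (t - p) * ((t + Complex.I) ^ 2)⁻¹ := by
      field_simp [hne t, hne' t]
    rw [e, norm_mul, norm_inv, norm_pow, ← Complex.normSq_eq_norm_sq]
    have e2 : Complex.normSq (t + Complex.I) = 1 + t ^ 2 := by
      simp [Complex.normSq_apply]; ring
    rw [e2]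
    gcongr
    exact hK t
  refine ⟨hint, ?_⟩
  have tl : ∀ q : ℂ, ∀ b : ℂ, b ∈ Complex.slitPlane →
      Tendsto (fun t : ℝ => Complex.log (b + q * (t : ℂ)⁻¹)) atTop (𝓝 (Complex.log b)) := by
    intro q b hb
    have h1 : Tendsto (fun t : ℝ => b + q * (t : ℂ)⁻¹) atTop (𝓝 (b + q * 0)) := by
      refine tendsto_const_nhds.add (tendsto_const_nhds.mul ?_)
      have := (Complex.continuous_ofReal.tendsto 0).comp tendsto_inv_atTop_zero
      simpa [Function.comp_def] using this
    rw [mul_zero, add_zero] at h1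
    exact ((continuousAt_clog hb).tendsto).comp h1
  set F : ℝ → ℂ := fun t => (p + Complex.I)⁻¹ *
    (Complex.log (Complex.I * (t - p)) - Complex.log (-Complex.I * (t + Complex.I))) with hF
  have hd : ∀ t : ℝ, HasDerivAt F ((t + Complex.I) * (t - p) : ℂ)⁻¹ t := by
    intro t
    have d0 : HasDerivAt (fun t : ℝ => (t : ℂ)) 1 t := Complex.ofRealCLM.hasDerivAt
    have d1 := ((d0.sub_const p).const_mul Complex.I).clog_real (by
      left; simpa using hp)
    have d2 := ((d0.add_const Complex.I).const_mul (-Complex.I)).clog_real (by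
      left; simp)
    convert! (d1.sub d2).const_mul (p + Complex.I)⁻¹ using 1
    have h1 := hne t
    have h2 := hne' t
    have hI := Complex.I_ne_zero
    field_simp
    ring
  have ltop : Tendsto F atTop (𝓝 ((p + Complex.I)⁻¹ * (Complex.log Complex.I -
      Complex.log (-Complex.I)))) := by
    refine Tendsto.const_mul _ (((tl (-Complex.I * p) Complex.I ?_).sub (tl 1 (-Complex.I) ?_)).congr' ?_)
    · right; simp
    · right; simp
    · filter_upwards [eventually_gt_atTop 0] with t ht
      have e1 : Complex.I * (t - p) = t * (Complex.I + -Complex.I * p * (t : ℂ)⁻¹) := by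
        have : (t : ℂ) ≠ 0 := by exact_mod_cast ht.ne'
        field_simp
        ring
      have e2 : -Complex.I * (t + Complex.I) = t * (-Complex.I + 1 * (t : ℂ)⁻¹) := by
        have : (t : ℂ) ≠ 0 := by exact_mod_cast ht.ne'
        field_simp
        linear_combination - Complex.I_sq
      have n1 := mul_ne_zero Complex.I_ne_zero (hne t)
      have n2 := mul_ne_zero (neg_ne_zero.mpr Complex.I_ne_zero) (hne' t)
      rw [e1] at n1
      rw [e2] at n2
      rw [e1, e2, Complex.log_ofReal_mul ht (right_ne_zero_of_mul n1),
        Complex.log_ofReal_mul ht (right_ne_zero_of_mul n2)]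
      ring
  have lbot : Tendsto F atBot (𝓝 ((p + Complex.I)⁻¹ * (Complex.log (-Complex.I) -
      Complex.log Complex.I))) := by
    suffices h : Tendsto (fun s : ℝ => F (-s)) atTop (𝓝 ((p + Complex.I)⁻¹ *
        (Complex.log (-Complex.I) - Complex.log Complex.I))) by
      simpa [Function.comp_def] using h.comp tendsto_neg_atBot_atTop
    refine Tendsto.const_mul _ (((tl (-Complex.I * p) (-Complex.I) ?_).sub (tl 1 Complex.I ?_)).congr' ?_)
    · right; simp
    · right; simp
    · filter_upwards [eventually_gt_atTop 0] with t ht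
      have e1 : Complex.I * ((-t : ℝ) - p) = t * (-Complex.I + -Complex.I * p * (t : ℂ)⁻¹) := by
        have : (t : ℂ) ≠ 0 := by exact_mod_cast ht.ne'
        field_simp
        push_cast
        ring
      have e2 : -Complex.I * ((-t : ℝ) + Complex.I) = t * (Complex.I + 1 * (t : ℂ)⁻¹) := by
        have : (t : ℂ) ≠ 0 := by exact_mod_cast ht.ne'
        field_simp
        push_cast
        linear_combination - Complex.I_sq
      have n1 := mul_ne_zero Complex.I_ne_zero (hne (-t))
      have n2 := mul_ne_zero (neg_ne_zero.mpr Complex.I_ne_zero) (hne' (-t))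
      rw [e1] at n1
      rw [e2] at n2
      rw [e1, e2, Complex.log_ofReal_mul ht (right_ne_zero_of_mul n1),
        Complex.log_ofReal_mul ht (right_ne_zero_of_mul n2)]
      ring
  rw [integral_of_hasDerivAt_of_tendsto hd hint lbot ltop, Complex.log_I, Complex.log_neg_I]
  field_simp
  ring

theorem exp_sub_exp_ne_zero_of_mem {w z : ℂ} (hw : w ∈ openStrip) (hz : z ∈ openStrip) (h : w ≠ z) :
    Complex.exp w - Complex.exp z ≠ 0 := fun h0 =>
  h (eq_of_exp_eq_of_mem_openStrip hw hz (sub_eq_zero.mp h0))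

theorem exp_add_I_ne_zero_of_mem {w : ℂ} (hw : w ∈ openStrip) :
    Complex.exp w + Complex.I ≠ 0 := fun h0 =>
  exp_ne_neg_I_of_mem hw (eq_neg_of_add_eq_zero_left h0)

/-- The Cauchy kernel in the exponential coordinate, with the pole divided out. -/
theorem exists_strip_quotient {U : Set ℂ} {n : ℂ → ℂ} {w₀ : ℂ} (hUo : IsOpen U)
    (hUs : U ⊆ openStrip) (hw₀ : w₀ ∈ U)
    (hn : DifferentiableOn ℂ n U) (hn0 : n w₀ = 0) :
    ∃ f : ℂ → ℂ, DifferentiableOn ℂ f U ∧ ∀ w ∈ U, w ≠ w₀ →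
      f w = n w * (Complex.exp w / (Complex.exp w - Complex.exp w₀)) := by
  have hU := hUo.mem_nhds hw₀
  have hden : ∀ w ∈ U, dslope Complex.exp w₀ w ≠ 0 := by
    intro w hw
    rcases eq_or_ne w w₀ with rfl | h
    · rw [dslope_same, Complex.deriv_exp]
      exact Complex.exp_ne_zero _
    · rw [dslope_of_ne _ h, slope_def_field]
      exact div_ne_zero (exp_sub_exp_ne_zero_of_mem (hUs hw) (hUs hw₀) h) (sub_ne_zero.mpr h)
  refine ⟨fun w => dslope n w₀ w / dslope Complex.exp w₀ w * Complex.exp w, ?_, ?_⟩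
  · refine DifferentiableOn.mul (DifferentiableOn.div ?_ ?_ hden)
      Complex.differentiable_exp.differentiableOn
    · exact (Complex.differentiableOn_dslope hU).mpr hn
    · exact (Complex.differentiableOn_dslope hU).mpr Complex.differentiable_exp.differentiableOn
  · intro w hw h
    have h1 := exp_sub_exp_ne_zero_of_mem (hUs hw) (hUs hw₀) h
    have h2 := sub_ne_zero.mpr h
    simp only [dslope_of_ne _ h, slope_def_field, hn0, sub_zero]
    field_simp

/-- Bounds for the Cauchy kernel in the exponential coordinate far out in the strip. -/
theorem norm_exp_div_exp_sub_le_of_ge {w q : ℂ} (h : 2 * ‖q‖ ≤ Real.exp w.re) :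
    ‖Complex.exp w / (Complex.exp w - q)‖ ≤ 2 ∧ ‖(Complex.exp w - q)⁻¹‖ ≤ 2 * Real.exp (-w.re) := by
  have h1 : Real.exp w.re / 2 ≤ ‖Complex.exp w - q‖ := by
    have := norm_sub_norm_le (Complex.exp w) q
    rw [Complex.norm_exp] at this
    linarith
  have hE := Real.exp_pos w.re
  constructor
  · rw [norm_div, Complex.norm_exp, div_le_iff₀ (by linarith)]
    linarith
  · rw [norm_inv, Real.exp_neg, ← div_eq_mul_inv, inv_le_comm₀ (by linarith) (by positivity), inv_div]
    exact h1

theorem norm_inv_exp_sub_le_of_le {w q : ℂ} (hq : q ≠ 0) (h : Real.exp w.re ≤ ‖q‖ / 2) :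
    ‖(Complex.exp w - q)⁻¹‖ ≤ 2 / ‖q‖ := by
  have hq' := norm_pos_iff.mpr hq
  have h1 : ‖q‖ / 2 ≤ ‖Complex.exp w - q‖ := by
    have := norm_sub_norm_le q (Complex.exp w)
    rw [Complex.norm_exp, norm_sub_rev] at this
    linarith
  rw [norm_inv, inv_le_comm₀ (by linarith) (by positivity), inv_div]
  exact h1

theorem cauchy_strip_exp {U : Set ℂ} {Φ : ℂ → ℂ} {M : ℝ} {w₀ : ℂ}
    (hUo : IsOpen U) (hUs : U ⊆ openStrip) (hcU : ∀ w : ℂ, 0 ≤ w.im → w.im ≤ π → w ∈ U)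
    (hΦ : DifferentiableOn ℂ Φ U)
    (hM : ∀ w : ℂ, 0 ≤ w.im → w.im ≤ π → ‖Φ w‖ ≤ M)
    (hM' : ∀ w : ℂ, 0 ≤ w.im → w.im ≤ π → ‖Φ w‖ ≤ M * Real.exp (-(w.re / 2)))
    (h0 : 0 < w₀.im) (h1 : w₀.im < π) :
    ∃ n : ℂ → ℂ, (∀ w, n w = Φ w - Φ w₀ * (Complex.exp w₀ + Complex.I) / (Complex.exp w + Complex.I)) ∧
    Integrable (fun u : ℝ => n u * (Complex.exp u / (Complex.exp u - Complex.exp w₀))) ∧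
    Integrable (fun u : ℝ => n (u + π * Complex.I) *
      (Complex.exp u / (Complex.exp u + Complex.exp w₀))) ∧
    ∫ u : ℝ, n u * (Complex.exp u / (Complex.exp u - Complex.exp w₀)) =
      ∫ u : ℝ, n (u + π * Complex.I) * (Complex.exp u / (Complex.exp u + Complex.exp w₀)) := by
  set p := Complex.exp w₀ with hp
  set c := Φ w₀ * (p + Complex.I) with hc
  set n : ℂ → ℂ := fun w => Φ w - c / (Complex.exp w + Complex.I) with hn
  have hw₀ : w₀ ∈ openStrip := mem_openStrip_of_mem_Icc h0.le h1.le
  have hp0 : p ≠ 0 := Complex.exp_ne_zero _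
  have hp0' := norm_pos_iff.mpr hp0
  have hM0 : 0 ≤ M := (norm_nonneg _).trans (hM w₀ h0.le h1.le)
  obtain ⟨f, hfd, hf⟩ := exists_strip_quotient (n := n) hUo hUs (hcU w₀ h0.le h1.le)
    (hΦ.sub (DifferentiableOn.div (differentiableOn_const c)
      (Complex.differentiable_exp.differentiableOn.add_const _)
      fun w hw => exp_add_I_ne_zero_of_mem (hUs hw))) (by
      have := exp_add_I_ne_zero_of_mem hw₀
      rw [hn, hc]
      simp only
      rw [mul_div_assoc, div_self this, mul_one, sub_self])
  set R : ℝ := Real.log (2 * (‖p‖ + 1)) + |Real.log (‖p‖ / 2)| + 1 with hR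
  have hlogpos : 0 ≤ Real.log (2 * (‖p‖ + 1)) := Real.log_nonneg (by linarith)
  have hRpos : 0 < R := by positivity
  obtain ⟨K, hK⟩ : ∃ K, ∀ w : ℂ, 0 ≤ w.im → w.im ≤ π → R + |w₀.re| + 1 ≤ |w.re| →
      ‖f w‖ ≤ K * Real.exp (-(|w.re| / 2)) := by
    refine ⟨max (2 * (M + ‖c‖ * 2)) ((M + ‖c‖ * 2) * (2 / ‖p‖)), fun w hw0 hw1 hwR => ?_⟩
    have hmem := hcU w hw0 hw1
    have hne : w ≠ w₀ := by
      rintro rfl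
      linarith
    rw [hf w hmem hne, norm_mul]
    have hnw : ‖n w‖ ≤ ‖Φ w‖ + ‖c‖ * ‖(Complex.exp w - -Complex.I)⁻¹‖ := by
      rw [sub_neg_eq_add, ← norm_mul, ← div_eq_mul_inv]
      exact norm_sub_le _ _
    have ha := abs_nonneg w₀.re
    have hb := abs_nonneg (Real.log (‖p‖ / 2))
    rcases le_total 0 w.re with hs | hs
    · rw [abs_of_nonneg hs] at hwR ⊢
      have hbig : 2 * (‖p‖ + 1) ≤ Real.exp w.re := by
        rw [← Real.log_le_iff_le_exp (by positivity)]
        linarith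
      have k1 := (norm_exp_div_exp_sub_le_of_ge (w := w) (q := p) (by linarith)).1
      have k2 := (norm_exp_div_exp_sub_le_of_ge (w := w) (q := -Complex.I) (by simp; linarith)).2
      have k3 : Real.exp (-w.re) ≤ Real.exp (-(w.re / 2)) := Real.exp_le_exp.mpr (by linarith)
      calc ‖n w‖ * ‖Complex.exp w / (Complex.exp w - p)‖
          ≤ (M * Real.exp (-(w.re / 2)) + ‖c‖ * (2 * Real.exp (-(w.re / 2)))) * 2 := by
            gcongr
            refine hnw.trans ?_
            gcongr
            · exact hM' w hw0 hw1
            · exact k2.trans (by gcongr)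
        _ = 2 * (M + ‖c‖ * 2) * Real.exp (-(w.re / 2)) := by ring
        _ ≤ _ := by gcongr; exact le_max_left _ _
    · rw [abs_of_nonpos hs] at hwR ⊢
      have hsm : Real.exp w.re ≤ ‖p‖ / 2 := by
        rw [← Real.le_log_iff_exp_le (by positivity)]
        have := neg_abs_le (Real.log (‖p‖ / 2))
        linarith
      have hsm2 : Real.exp w.re ≤ 1 / 2 := by
        rw [← Real.le_log_iff_exp_le (by positivity), one_div, Real.log_inv]
        have : Real.log 2 ≤ Real.log (2 * (‖p‖ + 1)) := Real.log_le_log (by norm_num) (by linarith)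
        linarith
      have k1 := norm_inv_exp_sub_le_of_le hp0 hsm
      have k2 := norm_inv_exp_sub_le_of_le (w := w) (neg_ne_zero.mpr Complex.I_ne_zero)
        (by simpa using hsm2)
      have k3 : Real.exp w.re ≤ Real.exp (-(-w.re / 2)) := Real.exp_le_exp.mpr (by linarith)
      calc ‖n w‖ * ‖Complex.exp w / (Complex.exp w - p)‖
          ≤ (M + ‖c‖ * 2) * (Real.exp (-(-w.re / 2)) * (2 / ‖p‖)) := by
            gcongr
            · refine hnw.trans ?_
              gcongr
              · exact hM w hw0 hw1
              · simpa using k2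
            · rw [div_eq_mul_inv, norm_mul, Complex.norm_exp]
              gcongr
        _ = (M + ‖c‖ * 2) * (2 / ‖p‖) * Real.exp (-(-w.re / 2)) := by ring
        _ ≤ _ := by gcongr; exact le_max_right _ _
  obtain ⟨K', -, hK'⟩ := exists_norm_le_exp_neg_abs hcU hfd.continuousOn hK
  have e0 : ∀ u : ℝ, f u = n u * (Complex.exp u / (Complex.exp u - p)) := by
    intro u
    refine hf u (hcU u (by simp) (by simpa using Real.pi_pos.le)) fun h => ?_
    have := congrArg Complex.im h
    simp at this
    linarith
  have e1 : ∀ u : ℝ, f (u + π * Complex.I) =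
      n (u + π * Complex.I) * (Complex.exp u / (Complex.exp u + p)) := by
    intro u
    rw [hf _ (hcU _ (by simpa using Real.pi_pos.le) (by simp)) fun h => ?_]
    · rw [Complex.exp_add, Complex.exp_pi_mul_I, mul_neg_one, ← neg_add', neg_div_neg_eq]
    · have := congrArg Complex.im h
      simp at this
      linarith
  have i0 : Integrable (fun u : ℝ => f u) := by
    simpa using integrable_of_norm_le_exp_neg_abs (v := 0) hcU hfd.continuousOn le_rfl
      Real.pi_pos.le hK'
  have i1 : Integrable (fun u : ℝ => f (u + π * Complex.I)) :=
    integrable_of_norm_le_exp_neg_abs hcU hfd.continuousOn Real.pi_pos.le le_rfl hK'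
  have key := integral_eq_integral_add_pi_mul_I hcU hfd hK'
  simp only [e0] at i0 key
  simp only [e1] at i1 key
  exact ⟨n, fun w => rfl, i0, i1, key⟩

theorem exp_image_univ : Real.exp '' univ = Ioi 0 := by
  rw [image_univ, Real.range_exp]

theorem integrable_exp_smul_comp_exp_iff (g : ℝ → ℂ) :
    Integrable (fun u : ℝ => Real.exp u • g (Real.exp u)) ↔ IntegrableOn g (Ioi 0) := by
  rw [← exp_image_univ, integrableOn_image_iff_integrableOn_abs_deriv_smul MeasurableSet.univ
    (fun x _ => (Real.hasDerivAt_exp x).hasDerivWithinAt) Real.exp_injective.injOn]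
  simp [integrableOn_univ]

theorem integral_exp_smul_comp_exp (g : ℝ → ℂ) :
    ∫ u : ℝ, Real.exp u • g (Real.exp u) = ∫ t in Ioi 0, g t := by
  rw [← exp_image_univ, integral_image_eq_integral_abs_deriv_smul MeasurableSet.univ
    (fun x _ => (Real.hasDerivAt_exp x).hasDerivWithinAt) Real.exp_injective.injOn]
  simp

theorem cauchy_strip {U : Set ℂ} {Φ : ℂ → ℂ} {M : ℝ} {w₀ : ℂ}
    (hUo : IsOpen U) (hUs : U ⊆ openStrip) (hcU : ∀ w : ℂ, 0 ≤ w.im → w.im ≤ π → w ∈ U)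
    (hΦ : DifferentiableOn ℂ Φ U)
    (hM : ∀ w : ℂ, 0 ≤ w.im → w.im ≤ π → ‖Φ w‖ ≤ M)
    (hM' : ∀ w : ℂ, 0 ≤ w.im → w.im ≤ π → ‖Φ w‖ ≤ M * Real.exp (-(w.re / 2)))
    (h0 : 0 < w₀.im) (h1 : w₀.im < π) :
    IntegrableOn (fun t : ℝ => Φ (Real.log t) / (t - Complex.exp w₀)) (Ioi 0) ∧
    IntegrableOn (fun t : ℝ => Φ (Real.log t + π * Complex.I) / (t + Complex.exp w₀)) (Ioi 0) ∧
    (∫ t in Ioi (0 : ℝ), Φ (Real.log t) / (t - Complex.exp w₀)) -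
      ∫ t in Ioi (0 : ℝ), Φ (Real.log t + π * Complex.I) / (t + Complex.exp w₀) =
      2 * π * Complex.I * Φ w₀ := by
  obtain ⟨n, hn, i0, i1, key⟩ := cauchy_strip_exp hUo hUs hcU hΦ hM hM' h0 h1
  have hw₀ : w₀ ∈ openStrip := mem_openStrip_of_mem_Icc h0.le h1.le
  have hpI := exp_add_I_ne_zero_of_mem hw₀
  have hpim : 0 < (Complex.exp w₀).im := by
    rw [Complex.exp_im]
    exact mul_pos (Real.exp_pos _) (Real.sin_pos_of_pos_of_lt_pi h0 h1)
  obtain ⟨Qi, Qe⟩ := integral_inv_add_I_mul_inv_sub hpim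
  set p := Complex.exp w₀ with hp
  set c := Φ w₀ * (p + Complex.I) with hc
  set Q : ℝ → ℂ := fun t => ((t + Complex.I) * (t - p) : ℂ)⁻¹ with hQ
  have hne1 : ∀ t : ℝ, (t : ℂ) - p ≠ 0 := fun t h => by
    have := congrArg Complex.im h
    simp at this
    linarith
  have hne2 : ∀ t : ℝ, (t : ℂ) + p ≠ 0 := fun t h => by
    have := congrArg Complex.im h
    simp at this
    linarith
  have hne3 : ∀ t : ℝ, (t : ℂ) + Complex.I ≠ 0 := fun t h => by
    have := congrArg Complex.im h
    simp at this
  have hne4 : ∀ t : ℝ, -(t : ℂ) + Complex.I ≠ 0 := fun t h => by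
    have := congrArg Complex.im h
    simp at this
  set A : ℝ → ℂ := fun t => Φ (Real.log t) / (t - p) with hA
  set B : ℝ → ℂ := fun t => Φ (Real.log t + π * Complex.I) / (t + p) with hB
  have e0 : (fun u : ℝ => n u * (Complex.exp u / (Complex.exp u - p))) =
      fun u => Real.exp u • (fun t => A t - c * Q t) (Real.exp u) := by
    funext u
    have k1 := hne1 (Real.exp u)
    have k3 := hne3 (Real.exp u)
    simp only [hA, hQ, hn, Real.log_exp, Complex.real_smul]
    push_cast at k1 k3 ⊢
    field_simp
  have e1 : (fun u : ℝ => n (u + π * Complex.I) * (Complex.exp u / (Complex.exp u + p))) =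
      fun u => Real.exp u • (fun t => B t + c * Q (-t)) (Real.exp u) := by
    funext u
    have k1 := hne2 (Real.exp u)
    have k3 := hne4 (Real.exp u)
    have k4 : -(Real.exp u : ℂ) - p ≠ 0 := by
      rw [← neg_add']; exact neg_ne_zero.mpr k1
    simp only [hB, hQ, hn, Real.log_exp, Complex.real_smul, Complex.exp_add, Complex.exp_pi_mul_I,
      mul_neg_one]
    push_cast at k1 k3 k4 ⊢
    rw [← neg_add', mul_neg, inv_neg]
    field_simp
    ring
  rw [e0] at i0
  rw [e1] at i1
  rw [e0, e1] at key
  replace i0 := (integrable_exp_smul_comp_exp_iff (fun t => A t - c * Q t)).mp i0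
  replace i1 := (integrable_exp_smul_comp_exp_iff (fun t => B t + c * Q (-t))).mp i1
  have g0 := integral_exp_smul_comp_exp (fun t => A t - c * Q t)
  have g1 := integral_exp_smul_comp_exp (fun t => B t + c * Q (-t))
  replace key := g0.symm.trans (key.trans g1)
  have Q1 : IntegrableOn (fun t => c * Q t) (Ioi 0) := (Qi.const_mul c).integrableOn
  have Q2 : IntegrableOn (fun t => c * Q (-t)) (Ioi 0) := (Qi.comp_neg.const_mul c).integrableOn
  have iA : IntegrableOn A (Ioi 0) := by
    refine (i0.add Q1).congr_fun (fun t _ => ?_) measurableSet_Ioi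
    simp
  have iB : IntegrableOn B (Ioi 0) := by
    refine (i1.sub Q2).congr_fun (fun t _ => ?_) measurableSet_Ioi
    simp
  refine ⟨iA, iB, ?_⟩
  rw [integral_sub iA Q1, integral_add iB Q2, integral_const_mul, integral_const_mul,
    integral_comp_neg_Ioi, neg_zero] at key
  have hsum : (∫ t in Iic (0 : ℝ), Q t) + ∫ t in Ioi (0 : ℝ), Q t = ∫ t, Q t :=
    intervalIntegral.integral_Iic_add_Ioi Qi.integrableOn Qi.integrableOn
  have : c * ∫ t, Q t = 2 * π * Complex.I * Φ w₀ := by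
    rw [Qe, hc]
    field_simp
  rw [← this, ← hsum]
  linear_combination key

/-! ### The Stieltjes transform of the density in `r` -/

/-- The density `γ` with `r x = ∫₀^∞ γ t * exp (-t x) dt`. -/
noncomputable def gammaFun (t : ℝ) : ℝ :=
  Real.sqrt 2 / (2 * π) * ((t / (1 + t ^ 2)) * Real.exp (-etaF t))

theorem exists_norm_exp_neg_etaExt_le : ∃ M, 0 < M ∧ ∀ w : ℂ, 0 ≤ w.im → w.im ≤ π →
    ‖Complex.exp (-etaExt w)‖ ≤ M ∧ ‖Complex.exp (-etaExt w)‖ ≤ M * Real.exp (-(w.re / 2)) := by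
  obtain ⟨M, hM⟩ := exists_abs_re_etaExt_sub_le
  refine ⟨Real.exp M, Real.exp_pos _, fun w h0 h1 => ?_⟩
  have h := abs_le.mp (hM w h0 h1)
  rw [Complex.norm_exp, Complex.neg_re, ← Real.exp_add]
  constructor
  · have := le_max_right w.re 0
    exact Real.exp_le_exp.mpr (by linarith)
  · have := le_max_left w.re 0
    exact Real.exp_le_exp.mpr (by linarith)

theorem differentiableOn_etaExt : DifferentiableOn ℂ etaExt openStrip := fun _ hw =>
  (hasDerivAt_etaExt hw).differentiableAt.differentiableWithinAt

theorem exp_neg_etaExt_log {t : ℝ} (ht : 0 < t) :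
    Complex.exp (-etaExt (Real.log t)) = Real.exp (-etaF t) := by
  rw [etaExt_ofReal, Real.exp_log ht]
  push_cast
  rfl

theorem exp_etaExt_log_add {t : ℝ} (ht : 0 < t) :
    Complex.exp (etaExt (Real.log t + π * Complex.I)) =
      (1 + Complex.I * t) / Real.exp (etaF t) := by
  rw [exp_etaExt_add_pi_mul_I, Real.exp_log ht]

theorem exp_log_add_pi_mul_I {t : ℝ} (ht : 0 < t) :
    Complex.exp (Real.log t + π * Complex.I) = -t := by
  rw [Complex.exp_add, Complex.exp_pi_mul_I, ← Complex.ofReal_exp, Real.exp_log ht]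
  ring

theorem cauchy_exp_neg_etaExt {w₀ : ℂ} (h0 : 0 < w₀.im) (h1 : w₀.im < π) :
    IntegrableOn (fun t : ℝ => (Real.exp (-etaF t) : ℂ) / (t - Complex.exp w₀)) (Ioi 0) ∧
    IntegrableOn (fun t : ℝ => (Real.exp (etaF t) : ℂ) /
      ((1 + Complex.I * t) * (t + Complex.exp w₀))) (Ioi 0) ∧
    (∫ t in Ioi (0 : ℝ), (Real.exp (-etaF t) : ℂ) / (t - Complex.exp w₀)) -
      (∫ t in Ioi (0 : ℝ), (Real.exp (etaF t) : ℂ) /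
        ((1 + Complex.I * t) * (t + Complex.exp w₀))) =
      2 * π * Complex.I * Complex.exp (-etaExt w₀) := by
  obtain ⟨M, -, hM⟩ := exists_norm_exp_neg_etaExt_le
  obtain ⟨iA, iB, key⟩ := cauchy_strip isOpen_openStrip subset_rfl
    (fun w => mem_openStrip_of_mem_Icc) (Φ := fun w => Complex.exp (-etaExt w))
    differentiableOn_etaExt.neg.cexp (fun w h h' => (hM w h h').1)
    (fun w h h' => (hM w h h').2) h0 h1
  have eA : EqOn (fun t : ℝ => Complex.exp (-etaExt (Real.log t)) / (t - Complex.exp w₀))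
      (fun t : ℝ => (Real.exp (-etaF t) : ℂ) / (t - Complex.exp w₀)) (Ioi 0) := fun t ht => by
    simp only [exp_neg_etaExt_log ht]
  have eB : EqOn (fun t : ℝ => Complex.exp (-etaExt (Real.log t + π * Complex.I)) /
      (t + Complex.exp w₀)) (fun t : ℝ => (Real.exp (etaF t) : ℂ) /
      ((1 + Complex.I * t) * (t + Complex.exp w₀))) (Ioi 0) := fun t ht => by
    simp only [Complex.exp_neg, exp_etaExt_log_add ht]
    rw [inv_div, div_div]
  rw [integrableOn_congr_fun eA measurableSet_Ioi] at iA
  rw [integrableOn_congr_fun eB measurableSet_Ioi] at iB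
  rw [setIntegral_congr_fun measurableSet_Ioi eA, setIntegral_congr_fun measurableSet_Ioi eB] at key
  exact ⟨iA, iB, key⟩

theorem cauchy_exp_neg_etaExt_div {q : ℂ} (hq : q.im < 0) :
    IntegrableOn (fun t : ℝ => (Real.exp (-etaF t) : ℂ) / ((t - q) * (t - Complex.I))) (Ioi 0) ∧
    IntegrableOn (fun t : ℝ => (Real.exp (etaF t) : ℂ) /
      ((1 + Complex.I * t) * (-t - q) * (t + Complex.I))) (Ioi 0) ∧
    (∫ t in Ioi (0 : ℝ), (Real.exp (-etaF t) : ℂ) / ((t - q) * (t - Complex.I))) -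
      (∫ t in Ioi (0 : ℝ), (Real.exp (etaF t) : ℂ) /
        ((1 + Complex.I * t) * (-t - q) * (t + Complex.I))) =
      2 * π * Complex.I * (Complex.exp (-etaExt ((π / 2 : ℝ) * Complex.I)) / (Complex.I - q)) := by
  obtain ⟨M, hM0, hM⟩ := exists_norm_exp_neg_etaExt_le
  set U : Set ℂ := openStrip ∩ {w | Complex.exp w ≠ q} with hU
  have hUo : IsOpen U := isOpen_openStrip.inter (isOpen_ne_fun Complex.continuous_exp continuous_const)
  have him : ∀ w : ℂ, 0 ≤ w.im → w.im ≤ π → 0 ≤ (Complex.exp w).im := fun w h h' => by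
    rw [Complex.exp_im]
    exact mul_nonneg (Real.exp_pos _).le (Real.sin_nonneg_of_nonneg_of_le_pi h h')
  have hnorm : ∀ w : ℂ, 0 ≤ w.im → w.im ≤ π → ‖(Complex.exp w - q)⁻¹‖ ≤ (-q.im)⁻¹ := by
    intro w h h'
    rw [norm_inv]
    have h3 := Complex.abs_im_le_norm (Complex.exp w - q)
    have h4 := le_abs_self (Complex.exp w - q).im
    rw [Complex.sub_im] at h3 h4
    have := him w h h'
    exact inv_anti₀ (by linarith) (by linarith)
  have hq0 : 0 < (-q.im)⁻¹ := by
    have : 0 < -q.im := by linarith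
    positivity
  obtain ⟨iA, iB, key⟩ := cauchy_strip (M := M * (-q.im)⁻¹) hUo inter_subset_left
    (fun w h h' => ⟨mem_openStrip_of_mem_Icc h h', fun h2 => by
      have := him w h h'
      rw [h2] at this
      linarith⟩) (Φ := fun w => Complex.exp (-etaExt w) / (Complex.exp w - q))
    ((differentiableOn_etaExt.mono inter_subset_left).neg.cexp.div
      (Complex.differentiable_exp.differentiableOn.sub_const q) fun w hw => sub_ne_zero.mpr hw.2)
    (fun w h h' => by
      rw [div_eq_mul_inv, norm_mul]
      exact mul_le_mul (hM w h h').1 (hnorm w h h') (norm_nonneg _) hM0.le)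
    (fun w h h' => by
      rw [div_eq_mul_inv, norm_mul]
      calc _ ≤ (M * Real.exp (-(w.re / 2))) * (-q.im)⁻¹ :=
            mul_le_mul (hM w h h').2 (hnorm w h h') (norm_nonneg _) (by positivity)
        _ = _ := by ring)
    (w₀ := (π / 2 : ℝ) * Complex.I) (by simpa using Real.pi_pos) (by simp; linarith [Real.pi_pos])
  simp only [exp_pi_div_two_mul_I] at iA iB key
  have eA : EqOn (fun t : ℝ => Complex.exp (-etaExt (Real.log t)) /
      (Complex.exp (Real.log t) - q) / (t - Complex.I))
      (fun t : ℝ => (Real.exp (-etaF t) : ℂ) / ((t - q) * (t - Complex.I))) (Ioi 0) := fun t ht => by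
    simp only [exp_neg_etaExt_log ht, ← Complex.ofReal_exp, Real.exp_log ht, div_div]
  have eB : EqOn (fun t : ℝ => Complex.exp (-etaExt (Real.log t + π * Complex.I)) /
      (Complex.exp (Real.log t + π * Complex.I) - q) /
      (t + Complex.I)) (fun t : ℝ => (Real.exp (etaF t) : ℂ) /
      ((1 + Complex.I * t) * (-t - q) * (t + Complex.I))) (Ioi 0) := fun t ht => by
    simp only [Complex.exp_neg, exp_etaExt_log_add ht, exp_log_add_pi_mul_I ht]
    rw [inv_div, div_div, div_div, mul_assoc]
  rw [integrableOn_congr_fun eA measurableSet_Ioi] at iA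
  rw [integrableOn_congr_fun eB measurableSet_Ioi] at iB
  rw [setIntegral_congr_fun measurableSet_Ioi eA, setIntegral_congr_fun measurableSet_Ioi eB] at key
  exact ⟨iA, iB, key⟩

theorem ofReal_sub_ne_zero {p : ℂ} (hp : p.im ≠ 0) (t : ℝ) : (t : ℂ) - p ≠ 0 := fun h => by
  have := congrArg Complex.im h
  simp at this
  exact hp this

theorem ofReal_add_ne_zero {p : ℂ} (hp : p.im ≠ 0) (t : ℝ) : (t : ℂ) + p ≠ 0 := fun h => by
  have := congrArg Complex.im h
  simp at this
  exact hp this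

theorem one_add_I_mul_ofReal_ne_zero (t : ℝ) : 1 + Complex.I * (t : ℂ) ≠ 0 := fun h => by
  have := congrArg Complex.re h
  simp at this

theorem integral_gammaFun_div {w₀ : ℂ} (h0 : 0 < w₀.im) (h1 : w₀.im < π)
    (hne : Complex.exp w₀ ≠ Complex.I) :
    ∫ t in Ioi (0 : ℝ), (gammaFun t : ℂ) / (t - Complex.exp w₀) =
      Complex.I * (Real.sqrt 2 / 2) *
        ((Complex.exp (-etaExt ((π / 2 : ℝ) * Complex.I)) - Complex.exp (-etaExt w₀)) /
          (Complex.I - Complex.exp w₀) +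
        conj (Complex.exp (-etaExt ((π / 2 : ℝ) * Complex.I))) / (Complex.I + Complex.exp w₀)) := by
  have hpim : 0 < (Complex.exp w₀).im := by
    rw [Complex.exp_im]
    exact mul_pos (Real.exp_pos _) (Real.sin_pos_of_pos_of_lt_pi h0 h1)
  obtain ⟨iA, iB, e⟩ := cauchy_exp_neg_etaExt h0 h1
  obtain ⟨iA', iB', e'⟩ := cauchy_exp_neg_etaExt (w₀ := (π / 2 : ℝ) * Complex.I)
    (by simpa using Real.pi_pos) (by simp; linarith [Real.pi_pos])
  obtain ⟨iA2, iB2, e2⟩ := cauchy_exp_neg_etaExt_div (q := conj (Complex.exp w₀)) (by simpa using hpim)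
  rw [exp_pi_div_two_mul_I] at iA' iB' e'
  set p := Complex.exp w₀
  set a := Complex.exp (-etaExt ((π / 2 : ℝ) * Complex.I))
  set b := Complex.exp (-etaExt w₀)
  have hd : Complex.I - p ≠ 0 := sub_ne_zero.mpr hne.symm
  have hd2 : Complex.I + p ≠ 0 := fun h => by
    have := congrArg Complex.im h
    simp at this
    linarith
  have e2c := congrArg conj e2
  rw [map_sub, ← integral_conj, ← integral_conj] at e2c
  have iA2c := (Complex.conjCLE.toContinuousLinearMap.integrable_comp iA2)
  have iB2c := (Complex.conjCLE.toContinuousLinearMap.integrable_comp iB2)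
  simp only [map_div₀, map_mul, map_sub, map_add, map_neg, Complex.conj_conj, Complex.conj_I,
    Complex.conj_ofReal, map_one, map_ofNat, ContinuousLinearEquiv.coe_coe, Complex.conjCLE_apply]
    at e2c iA2c iB2c
  set A : ℝ → ℂ := fun t => (Real.exp (-etaF t) : ℂ) / (t - p)
  set A' : ℝ → ℂ := fun t => (Real.exp (-etaF t) : ℂ) / (t - Complex.I)
  set B : ℝ → ℂ := fun t => (Real.exp (etaF t) : ℂ) / ((1 + Complex.I * t) * (t + p))
  set B' : ℝ → ℂ := fun t => (Real.exp (etaF t) : ℂ) / ((1 + Complex.I * t) * (t + Complex.I))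
  set A2 : ℝ → ℂ := fun t => (Real.exp (-etaF t) : ℂ) / ((t - p) * (t - -Complex.I))
  set B2 : ℝ → ℂ := fun t => (Real.exp (etaF t) : ℂ) /
    ((1 + -Complex.I * t) * (-t - p) * (t + -Complex.I))
  have hfun : (fun t : ℝ => (gammaFun t : ℂ) / (t - p)) = fun t => ((Real.sqrt 2 / (4 * π) : ℝ) : ℂ) *
      ((((A' t - A t) - (B' t - B t)) / (Complex.I - p)) + (A2 t - B2 t)) := by
    funext t
    have k1 := ofReal_sub_ne_zero hpim.ne' t
    have k2 := ofReal_add_ne_zero hpim.ne' t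
    have k3 := ofReal_sub_ne_zero (p := Complex.I) (by simp) t
    have k4 := ofReal_add_ne_zero (p := Complex.I) (by simp) t
    have k5 := one_add_I_mul_ofReal_ne_zero t
    have k6 : -(t : ℂ) - p ≠ 0 := by rw [← neg_add']; exact neg_ne_zero.mpr k2
    have k7 : 1 + -Complex.I * (t : ℂ) ≠ 0 := by
      simpa using one_add_I_mul_ofReal_ne_zero (-t)
    have eA : (A' t - A t) / (Complex.I - p) =
        (Real.exp (-etaF t) : ℂ) * ((t - p) * (t - Complex.I))⁻¹ := by
      simp only [A, A']
      field_simp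
      ring
    have eB : (B' t - B t) / (Complex.I - p) =
        -(Real.exp (etaF t) : ℂ) * ((1 + Complex.I * t) * (t + p) * (t + Complex.I))⁻¹ := by
      simp only [B, B']
      field_simp
      ring
    have f1 : (1 + Complex.I * t) * (t + Complex.I) = Complex.I * (1 + (t : ℂ) ^ 2) := by
      linear_combination (t : ℂ) * Complex.I_sq
    have f2 : (1 + -Complex.I * t) * (t + -Complex.I) = -Complex.I * (1 + (t : ℂ) ^ 2) := by
      linear_combination (t : ℂ) * Complex.I_sq
    have k8 : (1 + (t : ℂ) ^ 2) ≠ 0 := by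
      intro h
      rw [h, mul_zero] at f1
      exact mul_ne_zero k5 k4 f1
    have eBB : (B' t - B t) / (Complex.I - p) + B2 t = 0 := by
      rw [eB]
      simp only [B2]
      rw [mul_right_comm, f1, mul_right_comm (1 + -Complex.I * (t : ℂ)), f2]
      have := Complex.I_ne_zero
      rw [← neg_add']
      field_simp
      ring
    have eAA : (A' t - A t) / (Complex.I - p) + A2 t =
        (Real.exp (-etaF t) : ℂ) * (2 * t / ((1 + (t : ℂ) ^ 2) * (t - p))) := by
      rw [eA]
      simp only [A2, sub_neg_eq_add]
      have f3 : (1 + (t : ℂ) ^ 2) = (t - Complex.I) * (t + Complex.I) := by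
        linear_combination Complex.I_sq
      rw [f3]
      field_simp
      ring
    have hpi : (π : ℂ) ≠ 0 := by exact_mod_cast Real.pi_ne_zero
    rw [sub_div, sub_add_eq_add_sub, add_sub_assoc]
    have : (A' t - A t) / (Complex.I - p) + (A2 t - B2 t - (B' t - B t) / (Complex.I - p)) =
        ((A' t - A t) / (Complex.I - p) + A2 t) - ((B' t - B t) / (Complex.I - p) + B2 t) := by ring
    rw [this, eAA, eBB, sub_zero, gammaFun]
    push_cast
    field_simp
    ring
  have iAA : IntegrableOn (fun t => A' t - A t) (Ioi 0) := iA'.sub iA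
  have iBB : IntegrableOn (fun t => B' t - B t) (Ioi 0) := iB'.sub iB
  have i1 : IntegrableOn (fun t => ((A' t - A t) - (B' t - B t)) / (Complex.I - p)) (Ioi 0) :=
    (iAA.sub iBB).div_const _
  have i2 : IntegrableOn (fun t => A2 t - B2 t) (Ioi 0) := iA2c.sub iB2c
  rw [hfun, integral_const_mul, integral_add i1 i2, integral_div, integral_sub iAA iBB]
  rw [integral_sub iA' iA, integral_sub iB' iB, integral_sub iA2c iB2c, e2c]
  have hpi : (π : ℂ) ≠ 0 := by exact_mod_cast Real.pi_ne_zero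
  have : (∫ t in Ioi 0, A' t) - (∫ t in Ioi 0, A t) - ((∫ t in Ioi 0, B' t) - ∫ t in Ioi 0, B t) =
      2 * π * Complex.I * (a - b) := by linear_combination e' - e
  rw [this]
  push_cast
  rw [show -Complex.I - p = -(Complex.I + p) by ring]
  field_simp
  ring

theorem continuous_gammaFun : Continuous gammaFun := by
  have := continuous_etaF
  unfold gammaFun
  refine continuous_const.mul (Continuous.mul (Continuous.div (by fun_prop) (by fun_prop) ?_)
    (by fun_prop))
  intro t
  positivity

theorem gammaFun_nonneg {t : ℝ} (ht : 0 ≤ t) : 0 ≤ gammaFun t := by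
  unfold gammaFun
  positivity

theorem integrableOn_exp_neg_etaF_div :
    IntegrableOn (fun t : ℝ => (Real.exp (-etaF t) : ℂ) / (t - Complex.I)) (Ioi 0) := by
  have := (cauchy_exp_neg_etaExt (w₀ := (π / 2 : ℝ) * Complex.I)
    (by simpa using Real.pi_pos) (by simp; linarith [Real.pi_pos])).1
  rwa [exp_pi_div_two_mul_I] at this

theorem integrableOn_gammaFun : IntegrableOn gammaFun (Ioi 0) := by
  have h : IntegrableOn (fun t : ℝ =>
      ((Real.exp (-etaF t) : ℂ) / (t - Complex.I)).re) (Ioi 0) := integrableOn_exp_neg_etaF_div.re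
  refine IntegrableOn.congr_fun (h.const_mul (Real.sqrt 2 / (2 * π))) (fun t _ => ?_)
    measurableSet_Ioi
  simp only [gammaFun, Complex.div_re, Complex.normSq_apply, Complex.ofReal_re, Complex.ofReal_im,
    Complex.sub_re, Complex.sub_im, Complex.I_re, Complex.I_im]
  ring_nf

theorem integrableOn_gammaFun_div : IntegrableOn (fun t => gammaFun t / t) (Ioi 0) := by
  have h : IntegrableOn (fun t : ℝ =>
      ((Real.exp (-etaF t) : ℂ) / (t - Complex.I)).im) (Ioi 0) := integrableOn_exp_neg_etaF_div.im
  refine IntegrableOn.congr_fun (h.const_mul (Real.sqrt 2 / (2 * π))) (fun t ht => ?_)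
    measurableSet_Ioi
  have ht' : t ≠ 0 := (mem_Ioi.mp ht).ne'
  simp only [gammaFun, Complex.div_im, Complex.normSq_apply, Complex.ofReal_re, Complex.ofReal_im,
    Complex.sub_re, Complex.sub_im, Complex.I_re, Complex.I_im]
  field_simp
  ring

theorem exp_neg_etaExt_pi_div_two_mul_I :
    Complex.exp (-etaExt ((π / 2 : ℝ) * Complex.I)) =
      (Real.cos (π / 8) - Complex.I * Real.sin (π / 8)) / Real.sqrt 2 := by
  rw [Complex.exp_neg, exp_etaExt_pi_div_two_mul_I, mul_inv, ← Complex.exp_neg, ← neg_mul,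
    ← Complex.ofReal_neg, Complex.exp_mul_I, ← Complex.ofReal_cos, ← Complex.ofReal_sin,
    Real.cos_neg, Real.sin_neg]
  push_cast
  ring

theorem exp_log_add_pi_div_two_mul_I {a : ℝ} (ha : 0 < a) :
    Complex.exp (Real.log a + (π / 2 : ℝ) * Complex.I) = Complex.I * a := by
  rw [Complex.exp_add, exp_pi_div_two_mul_I, ← Complex.ofReal_exp, Real.exp_log ha, mul_comm]

theorem ofReal_sqrt_two_sq : ((Real.sqrt 2 : ℝ) : ℂ) ^ 2 = 2 := by
  rw [← Complex.ofReal_pow, Real.sq_sqrt (by norm_num)]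
  norm_num

theorem ofReal_sqrt_two_ne_zero : ((Real.sqrt 2 : ℝ) : ℂ) ≠ 0 := by
  exact_mod_cast (Real.sqrt_pos.mpr (by norm_num)).ne'

theorem integral_gammaFun_div_sub_I_mul {a : ℝ} (ha : 0 < a) (ha1 : a ≠ 1) :
    ∫ t in Ioi (0 : ℝ), (gammaFun t : ℂ) / (t - Complex.I * a) =
      (Real.cos (π / 8) - Complex.I * a * Real.sin (π / 8)) / (1 - a ^ 2) -
      (Real.sqrt 2 / 2) * Complex.exp (-etaExt (Real.log a + (π / 2 : ℝ) * Complex.I)) / (1 - a) := by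
  have h := integral_gammaFun_div (w₀ := Real.log a + (π / 2 : ℝ) * Complex.I)
    (by simpa using Real.pi_pos) (by simp; linarith [Real.pi_pos]) (by
      rw [exp_log_add_pi_div_two_mul_I ha]
      intro h
      have := congrArg Complex.im h
      simp at this
      exact ha1 this)
  rw [exp_log_add_pi_div_two_mul_I ha] at h
  rw [h, exp_neg_etaExt_pi_div_two_mul_I]
  generalize Complex.exp (-etaExt (Real.log a + (π / 2 : ℝ) * Complex.I)) = b
  simp only [map_div₀, map_sub, map_mul, Complex.conj_ofReal, Complex.conj_I]
  have k1 : (1 - a : ℂ) ≠ 0 := by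
    rw [sub_ne_zero]; exact_mod_cast ha1.symm
  have k2 : (1 + a : ℂ) ≠ 0 := by
    have : (1 + a : ℝ) ≠ 0 := by positivity
    exact_mod_cast this
  rw [show Complex.I - Complex.I * a = Complex.I * (1 - a) by ring,
    show Complex.I + Complex.I * a = Complex.I * (1 + a) by ring,
    show (1 - a ^ 2 : ℂ) = (1 - a) * (1 + a) by ring]
  have hI := Complex.I_ne_zero
  have h2 := ofReal_sqrt_two_ne_zero
  field_simp
  ring

theorem integral_gammaFun_div_add {s : ℝ} (hs : 0 < s) :
    ∫ t in Ioi (0 : ℝ), gammaFun t / (t + s) =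
      (s * Real.sin (π / 8) + Real.cos (π / 8)) / (1 + s ^ 2) -
      Real.sqrt 2 / 2 * Real.exp (etaF s) / (1 + s ^ 2) := by
  have hpi := Real.pi_pos
  set W : ℝ → ℂ := fun v => Real.log s + v * Complex.I with hW
  have hWc : Continuous W := by fun_prop
  have hexp : ∀ v, Complex.exp (W v) = s * (Real.cos v + Real.sin v * Complex.I) := by
    intro v
    rw [hW]
    simp only
    rw [Complex.exp_add, ← Complex.ofReal_exp, Real.exp_log hs, Complex.exp_mul_I]
    push_cast
    rfl
  have hmem : W π ∈ openStrip := mem_openStrip_of_mem_Icc (by simpa [hW] using hpi.le) (by simp [hW])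
  have l1 : Tendsto (fun v : ℝ => ∫ t in Ioi (0 : ℝ), (gammaFun t : ℂ) / (t - Complex.exp (W v)))
      (𝓝[<] π) (𝓝 (∫ t in Ioi (0 : ℝ), (gammaFun t : ℂ) / (t - Complex.exp (W π)))) := by
    refine tendsto_integral_filter_of_dominated_convergence (fun t => gammaFun t / t) ?_ ?_
      integrableOn_gammaFun_div ?_
    · filter_upwards [Ioo_mem_nhdsLT (show π / 2 < π by linarith)] with v hv
      refine (Continuous.div (by have := continuous_gammaFun; fun_prop) (by fun_prop)
        (ofReal_sub_ne_zero ?_)).aestronglyMeasurable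
      rw [hexp]
      have := Real.sin_pos_of_pos_of_lt_pi (by linarith [hv.1]) hv.2
      simp
      exact ⟨hs.ne', this.ne'⟩
    · filter_upwards [Ioo_mem_nhdsLT (show π / 2 < π by linarith)] with v hv
      refine (ae_restrict_iff' measurableSet_Ioi).mpr (Eventually.of_forall fun t ht => ?_)
      rw [norm_div, Complex.norm_real, Real.norm_of_nonneg (gammaFun_nonneg (le_of_lt ht))]
      refine div_le_div_of_nonneg_left (gammaFun_nonneg (le_of_lt ht)) ht ?_
      refine le_trans ?_ (Complex.abs_re_le_norm _)
      refine le_trans ?_ (le_abs_self _)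
      rw [hexp]
      have := Real.cos_nonpos_of_pi_div_two_le_of_le hv.1.le (by linarith [hv.2])
      simp
      exact mul_nonpos_of_nonneg_of_nonpos hs.le this
    · refine (ae_restrict_iff' measurableSet_Ioi).mpr (Eventually.of_forall fun t ht => ?_)
      refine Tendsto.mono_left (ContinuousAt.tendsto ?_) nhdsWithin_le_nhds
      refine ContinuousAt.div (by fun_prop) (by fun_prop) ?_
      rw [hexp]
      have : (t + s : ℝ) ≠ 0 := by have := mem_Ioi.mp ht; positivity
      simpa using (by exact_mod_cast this : (t + s : ℂ) ≠ 0)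
  have l2 : Tendsto (fun v : ℝ => Complex.I * (Real.sqrt 2 / 2) *
        ((Complex.exp (-etaExt ((π / 2 : ℝ) * Complex.I)) - Complex.exp (-etaExt (W v))) /
          (Complex.I - Complex.exp (W v)) +
        conj (Complex.exp (-etaExt ((π / 2 : ℝ) * Complex.I))) / (Complex.I + Complex.exp (W v))))
      (𝓝[<] π) (𝓝 (Complex.I * (Real.sqrt 2 / 2) *
        ((Complex.exp (-etaExt ((π / 2 : ℝ) * Complex.I)) - Complex.exp (-etaExt (W π))) /
          (Complex.I - Complex.exp (W π)) +
        conj (Complex.exp (-etaExt ((π / 2 : ℝ) * Complex.I))) / (Complex.I + Complex.exp (W π))))) := by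
    refine Tendsto.mono_left (ContinuousAt.tendsto ?_) nhdsWithin_le_nhds
    have c1 : ContinuousAt (fun v => etaExt (W v)) π :=
      ContinuousAt.comp (hasDerivAt_etaExt hmem).continuousAt hWc.continuousAt
    refine continuousAt_const.mul (ContinuousAt.add (ContinuousAt.div ?_ (by fun_prop) ?_)
      (ContinuousAt.div (by fun_prop) (by fun_prop) ?_))
    · exact continuousAt_const.sub c1.neg.cexp
    · rw [hexp]; intro h; simpa using congrArg Complex.im h
    · rw [hexp]; intro h; simpa using congrArg Complex.im h
  have key := tendsto_nhds_unique_of_eventuallyEq l1 l2 (by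
    filter_upwards [Ioo_mem_nhdsLT (show π / 2 < π by linarith)] with v hv
    refine integral_gammaFun_div (by simp [hW]; linarith [hv.1]) (by simpa [hW] using hv.2) ?_
    rw [hexp]
    intro h
    have h2 := congrArg Complex.re h
    simp at h2
    have := Real.cos_neg_of_pi_div_two_lt_of_lt hv.1 (by linarith [hv.2])
    rcases h2 with h2 | h2
    · exact hs.ne' h2
    · exact this.ne h2)
  have e1 : Complex.exp (W π) = -s := exp_log_add_pi_mul_I hs
  have e2 : Complex.exp (-etaExt (W π)) = Real.exp (etaF s) / (1 + Complex.I * s) := by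
    rw [Complex.exp_neg, exp_etaExt_log_add hs, inv_div]
  rw [e1, e2, exp_neg_etaExt_pi_div_two_mul_I] at key
  have key2 : ((∫ t in Ioi (0 : ℝ), gammaFun t / (t + s) : ℝ) : ℂ) =
      ∫ t in Ioi (0 : ℝ), (gammaFun t : ℂ) / (t - -(s : ℂ)) := by
    rw [← integral_complex_ofReal]
    simp
  rw [key] at key2
  apply Complex.ofReal_injective
  rw [key2]
  simp only [map_div₀, map_sub, map_mul, Complex.conj_ofReal, Complex.conj_I]
  have k1 := one_add_I_mul_ofReal_ne_zero s
  have k2 : Complex.I - -(s : ℂ) ≠ 0 := by intro h; simpa using congrArg Complex.im h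
  have k3 : Complex.I + -(s : ℂ) ≠ 0 := by intro h; simpa using congrArg Complex.im h
  have k4 : (1 + (s : ℂ) ^ 2) ≠ 0 := by
    have : (1 + s ^ 2 : ℝ) ≠ 0 := by positivity
    exact_mod_cast this
  have h2 := ofReal_sqrt_two_ne_zero
  push_cast
  generalize (Complex.sin (π / 8)) = S
  generalize (Complex.cos (π / 8)) = T
  generalize (Complex.exp (etaF s)) = h
  have f1 : (Complex.I - -(s : ℂ))⁻¹ = (s - Complex.I) / (1 + s ^ 2) := by
    field_simp; linear_combination Complex.I_sq
  have f2 : (Complex.I + -(s : ℂ))⁻¹ = -(s + Complex.I) / (1 + s ^ 2) := by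
    field_simp; linear_combination Complex.I_sq
  have f3 : (1 + Complex.I * (s : ℂ))⁻¹ = (1 - Complex.I * s) / (1 + s ^ 2) := by
    field_simp; linear_combination s ^ 2 * Complex.I_sq
  rw [div_eq_mul_inv _ (Complex.I - -(s : ℂ)), div_eq_mul_inv _ (Complex.I + -(s : ℂ)),
    div_eq_mul_inv _ (1 + Complex.I * (s : ℂ)), f1, f2, f3]
  field_simp
  ring_nf
  simp only [Complex.I_sq, show Complex.I ^ 3 = -Complex.I by rw [pow_succ, Complex.I_sq]; ring]
  ring

/-! ### The quotient `exp (η (a t) - η t)` -/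

theorem norm_inv_one_sub_I_mul_le {a : ℝ} (ha : 0 < a) {w : ℂ} (h0 : 0 ≤ w.im) (h1 : w.im ≤ π) :
    ‖(1 - Complex.I * a * Complex.exp w)⁻¹‖ ≤ 1 ∧
    ‖(1 - Complex.I * a * Complex.exp w)⁻¹‖ ≤ a⁻¹ * Real.exp (-w.re) := by
  have him : 0 ≤ (Complex.exp w).im := by
    rw [Complex.exp_im]
    exact mul_nonneg (Real.exp_pos _).le (Real.sin_nonneg_of_nonneg_of_le_pi h0 h1)
  have hre : 1 ≤ (1 - Complex.I * a * Complex.exp w).re := by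
    simp
    positivity
  have hn1 : 1 ≤ ‖1 - Complex.I * a * Complex.exp w‖ :=
    hre.trans ((le_abs_self _).trans (Complex.abs_re_le_norm _))
  have hn2 : a * Real.exp w.re ≤ ‖1 - Complex.I * a * Complex.exp w‖ := by
    rw [← Complex.norm_exp]
    refine abs_le_of_sq_le_sq' ?_ (norm_nonneg _) |>.2
    rw [mul_pow, ← Complex.normSq_eq_norm_sq, ← Complex.normSq_eq_norm_sq, Complex.normSq_apply,
      Complex.normSq_apply]
    simp only [Complex.sub_re, Complex.sub_im, Complex.mul_re, Complex.mul_im, Complex.one_re,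
      Complex.one_im, Complex.I_re, Complex.I_im, Complex.ofReal_re, Complex.ofReal_im]
    nlinarith [mul_nonneg ha.le him]
  rw [norm_inv]
  constructor
  · exact inv_le_one_of_one_le₀ hn1
  · rw [Real.exp_neg, ← mul_inv]
    exact inv_anti₀ (by positivity) hn2

theorem one_sub_I_mul_ne_zero {a : ℝ} (ha : 0 < a) {w : ℂ} (hw : w ∈ openStrip) :
    1 - Complex.I * a * Complex.exp w ≠ 0 := by
  intro h
  have hmem : w + Real.log a ∈ openStrip := by
    constructor
    · simpa using hw.1
    · simpa using hw.2
  apply one_sub_I_mul_exp_ne_zero hmem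
  rw [Complex.exp_add, ← Complex.ofReal_exp, Real.exp_log ha]
  linear_combination h

theorem integral_exp_etaF_sub {a : ℝ} (ha : 0 < a) (ha1 : a ≠ 1) :
    ∫ t in Ioi (0 : ℝ), t * Real.exp (etaF (a * t) - etaF t) / ((1 + t ^ 2) * (1 + (a * t) ^ 2)) =
      2 * π / (a ^ 2 - 1) * (Complex.exp (etaExt (Real.log a + (π / 2 : ℝ) * Complex.I) -
        etaExt ((π / 2 : ℝ) * Complex.I))).im := by
  obtain ⟨M, hM⟩ := exists_abs_re_etaExt_sub_le
  set L := Real.log a with hL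
  have hmemL : ∀ w ∈ openStrip, (L : ℂ) + w ∈ openStrip := fun w hw => by
    constructor
    · simpa using hw.1
    · simpa using hw.2
  set E : ℂ → ℂ := fun w => Complex.exp (etaExt (L + w) - etaExt w) with hE
  have hEd : DifferentiableOn ℂ E openStrip := by
    refine DifferentiableOn.cexp (DifferentiableOn.sub (fun w hw => ?_) differentiableOn_etaExt)
    have := (hasDerivAt_etaExt (hmemL w hw)).comp w ((hasDerivAt_id w).const_add (L : ℂ))
    exact this.differentiableAt.differentiableWithinAt
  set K := Real.exp (2 * M + |L| / 2) with hK
  have hEb : ∀ w : ℂ, 0 ≤ w.im → w.im ≤ π → ‖E w‖ ≤ K := by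
    intro w h0 h1
    have b1 := abs_le.mp (hM w h0 h1)
    have b2 := abs_le.mp (hM (L + w) (by simpa using h0) (by simpa using h1))
    rw [hE, Complex.norm_exp, hK]
    refine Real.exp_le_exp.mpr ?_
    have hmax : max (L + w).re 0 ≤ max w.re 0 + |L| := by
      refine max_le ?_ (by positivity)
      have := le_max_left w.re 0
      have := le_abs_self L
      simp
      linarith
    rw [Complex.sub_re]
    linarith [b1.1, b2.2]
  have hK0 : 0 < K := Real.exp_pos _
  obtain ⟨iA, iB, key⟩ := cauchy_strip (M := K * (1 + a⁻¹)) isOpen_openStrip subset_rfl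
    (fun w => mem_openStrip_of_mem_Icc) (Φ := fun w => E w / (1 - Complex.I * a * Complex.exp w))
    (hEd.div (by fun_prop) fun w hw => one_sub_I_mul_ne_zero ha hw)
    (fun w h0 h1 => by
      rw [div_eq_mul_inv, norm_mul]
      refine mul_le_mul (hEb w h0 h1) ?_ (norm_nonneg _) hK0.le
      have := (norm_inv_one_sub_I_mul_le ha h0 h1).1
      have : 0 < a⁻¹ := by positivity
      linarith)
    (fun w h0 h1 => by
      rw [div_eq_mul_inv, norm_mul, mul_assoc K]
      refine mul_le_mul (hEb w h0 h1) ?_ (norm_nonneg _) hK0.le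
      obtain ⟨b1, b2⟩ := norm_inv_one_sub_I_mul_le ha h0 h1
      have hai : 0 < a⁻¹ := by positivity
      have he := Real.exp_pos (-(w.re / 2))
      rcases le_total 0 w.re with h | h
      · have : Real.exp (-w.re) ≤ Real.exp (-(w.re / 2)) := Real.exp_le_exp.mpr (by linarith)
        nlinarith
      · have : 1 ≤ Real.exp (-(w.re / 2)) := Real.one_le_exp (by linarith)
        nlinarith)
    (w₀ := (π / 2 : ℝ) * Complex.I) (by simpa using Real.pi_pos) (by simp; linarith [Real.pi_pos])
  simp only [exp_pi_div_two_mul_I] at iA iB key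
  have hlog : ∀ t : ℝ, 0 < t → L + Real.log t = Real.log (a * t) := fun t ht =>
    (Real.log_mul ha.ne' ht.ne').symm
  have eA : ∀ t ∈ Ioi (0 : ℝ), (E (Real.log t) / (1 - Complex.I * a * Complex.exp (Real.log t)) /
      (t - Complex.I)).re =
      (1 - a) * (t * Real.exp (etaF (a * t) - etaF t) / ((1 + t ^ 2) * (1 + (a * t) ^ 2))) := by
    intro t ht
    have ht' : 0 < t := ht
    have e1 : E (Real.log t) = Real.exp (etaF (a * t) - etaF t) := by
      simp only [hE]
      rw [← Complex.ofReal_add, hlog t ht, etaExt_ofReal, etaExt_ofReal, Real.exp_log ht,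
        Real.exp_log (by positivity)]
      push_cast
      rfl
    have e2 : (1 - Complex.I * a * Complex.exp (Real.log t))⁻¹ * (t - Complex.I)⁻¹ =
        ((((1 - a) * t : ℝ) : ℂ) + ((1 + a * t ^ 2 : ℝ) : ℂ) * Complex.I) *
          (((1 + t ^ 2) * (1 + (a * t) ^ 2) : ℝ) : ℂ)⁻¹ := by
      rw [← Complex.ofReal_exp, Real.exp_log ht']
      have n1 : 1 - Complex.I * a * t ≠ 0 := by
        intro h; simpa using congrArg Complex.re h
      have n2 := ofReal_sub_ne_zero (p := Complex.I) (by simp) t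
      have n3 : (1 + t ^ 2) * (1 + (a * t) ^ 2) ≠ 0 := by positivity
      have n3' : (1 + (t : ℂ) ^ 2) * (1 + ((a : ℂ) * t) ^ 2) ≠ 0 := by exact_mod_cast n3
      have n4 := right_ne_zero_of_mul n3'
      have n5 := left_ne_zero_of_mul n3'
      have f1 : (1 - Complex.I * a * t)⁻¹ = (1 + Complex.I * a * t) / (1 + ((a : ℂ) * t) ^ 2) := by
        rw [eq_div_iff n4, inv_mul_eq_iff_eq_mul₀ n1]
        linear_combination (a : ℂ) ^ 2 * (t : ℂ) ^ 2 * Complex.I_sq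
      have f2 : ((t : ℂ) - Complex.I)⁻¹ = (t + Complex.I) / (1 + (t : ℂ) ^ 2) := by
        rw [eq_div_iff n5, inv_mul_eq_iff_eq_mul₀ n2]
        linear_combination Complex.I_sq
      rw [f1, f2, div_mul_div_comm, div_eq_mul_inv]
      push_cast
      rw [mul_comm (1 + ((a : ℂ) * t) ^ 2)]
      congr 1
      linear_combination (a : ℂ) * t * Complex.I_sq
    rw [div_div, div_eq_mul_inv, mul_inv, e1, e2, ← Complex.ofReal_inv]
    rw [← mul_assoc, mul_comm, Complex.re_ofReal_mul, Complex.re_ofReal_mul]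
    rw [Complex.add_re, Complex.re_ofReal_mul, Complex.ofReal_re, Complex.I_re]
    ring
  have eB : ∀ t ∈ Ioi (0 : ℝ), (E (Real.log t + π * Complex.I) /
      (1 - Complex.I * a * Complex.exp (Real.log t + π * Complex.I)) / (t + Complex.I)).re = 0 := by
    intro t ht
    have ht' : 0 < t := ht
    have n1 := one_add_I_mul_ofReal_ne_zero (a * t)
    have n2 := ofReal_add_ne_zero (p := Complex.I) (by simp) t
    have n3 := one_add_I_mul_ofReal_ne_zero t
    have e1 : E (Real.log t + π * Complex.I) = (1 + Complex.I * (a * t : ℝ)) /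
        Real.exp (etaF (a * t)) * (Real.exp (etaF t) / (1 + Complex.I * t)) := by
      simp only [hE]
      rw [← add_assoc, ← Complex.ofReal_add, hlog t ht, sub_eq_add_neg, Complex.exp_add,
        Complex.exp_neg, exp_etaExt_log_add ht', exp_etaExt_log_add (by positivity), inv_div]
    have e2 : 1 - Complex.I * a * Complex.exp (Real.log t + π * Complex.I) =
        1 + Complex.I * (a * t : ℝ) := by
      rw [exp_log_add_pi_mul_I ht']
      push_cast
      ring
    have e3 : (1 + Complex.I * t) * (t + Complex.I) = Complex.I * (1 + (t : ℂ) ^ 2) := by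
      linear_combination (t : ℂ) * Complex.I_sq
    rw [e1, e2]
    have h1 : (Real.exp (etaF (a * t)) : ℂ) ≠ 0 := by exact_mod_cast (Real.exp_pos _).ne'
    have : (1 + Complex.I * (a * t : ℝ)) / Real.exp (etaF (a * t)) *
        (Real.exp (etaF t) / (1 + Complex.I * t)) / (1 + Complex.I * (a * t : ℝ)) /
        (t + Complex.I) = ((Real.exp (etaF t) / Real.exp (etaF (a * t)) / (1 + t ^ 2) : ℝ) : ℂ) *
          (-Complex.I) := by
      have : (1 + Complex.I * (a * t : ℝ)) / Real.exp (etaF (a * t)) *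
        (Real.exp (etaF t) / (1 + Complex.I * t)) / (1 + Complex.I * (a * t : ℝ)) /
        (t + Complex.I) = Real.exp (etaF t) / Real.exp (etaF (a * t)) /
          ((1 + Complex.I * t) * (t + Complex.I)) := by
        field_simp
      rw [this, e3, ← div_div, div_right_comm, div_eq_mul_inv _ Complex.I, Complex.inv_I]
      push_cast
      ring
    rw [this, Complex.re_ofReal_mul]
    simp
  have key2 := congrArg Complex.re key
  rw [Complex.sub_re, ← RCLike.re_eq_complex_re, ← integral_re iA, ← integral_re iB] at key2
  simp only [RCLike.re_eq_complex_re] at key2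
  rw [setIntegral_congr_fun measurableSet_Ioi eA, setIntegral_congr_fun measurableSet_Ioi eB,
    integral_const_mul] at key2
  have hI : 1 - Complex.I * a * Complex.I = ((1 + a : ℝ) : ℂ) := by
    push_cast
    linear_combination -(a : ℂ) * Complex.I_sq
  rw [hI] at key2
  have hR : (2 * π * Complex.I * (E ((π / 2 : ℝ) * Complex.I) / ((1 + a : ℝ) : ℂ))).re =
      -(2 * π * ((E ((π / 2 : ℝ) * Complex.I)).im / (1 + a))) := by
    rw [← Complex.div_ofReal_im]
    generalize E ((π / 2 : ℝ) * Complex.I) / ((1 + a : ℝ) : ℂ) = z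
    simp
  rw [hR] at key2
  have hne : (1 - a) ≠ 0 := sub_ne_zero.mpr ha1.symm
  have hne2 : (1 + a) ≠ 0 := by positivity
  have hne3 : a ^ 2 - 1 ≠ 0 := by
    rw [show a ^ 2 - 1 = -((1 - a) * (1 + a)) by ring]
    exact neg_ne_zero.mpr (mul_ne_zero hne hne2)
  simp only [integral_zero, sub_zero] at key2
  refine mul_left_cancel₀ hne (key2.trans ?_)
  simp only [hE]
  generalize (Complex.exp _).im = y
  rw [show a ^ 2 - 1 = -((1 - a) * (1 + a)) by ring]
  field_simp

/-! ### The remainder term as a Laplace transform -/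

theorem rfun_eq (x : ℝ) : rfun x = ∫ t in Ioi (0 : ℝ), Real.exp (-(t * x)) * gammaFun t := by
  rw [rfun, ← integral_const_mul]
  refine integral_congr_ae (ae_of_all _ fun t => ?_)
  simp only [gammaFun, neg_mul]
  ring

theorem integrableOn_exp_neg_mul_gammaFun {x : ℝ} (hx : 0 ≤ x) :
    IntegrableOn (fun t => Real.exp (-(t * x)) * gammaFun t) (Ioi 0) := by
  refine Integrable.bdd_mul (c := 1) integrableOn_gammaFun (by fun_prop) ?_
  refine (ae_restrict_iff' measurableSet_Ioi).mpr (ae_of_all _ fun t (ht : 0 < t) => ?_)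
  rw [Real.norm_eq_abs, abs_of_pos (Real.exp_pos _), Real.exp_le_one_iff]
  nlinarith [mul_nonneg ht.le hx]

theorem rfun_nonneg (x : ℝ) : 0 ≤ rfun x := by
  rw [rfun_eq]
  exact setIntegral_nonneg measurableSet_Ioi fun t (ht : 0 < t) =>
    mul_nonneg (Real.exp_pos _).le (gammaFun_nonneg ht.le)

theorem rfun_anti {x y : ℝ} (hx : 0 ≤ x) (hxy : x ≤ y) : rfun y ≤ rfun x := by
  rw [rfun_eq, rfun_eq]
  refine setIntegral_mono_on (integrableOn_exp_neg_mul_gammaFun (hx.trans hxy))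
    (integrableOn_exp_neg_mul_gammaFun hx) measurableSet_Ioi fun t (ht : 0 < t) => ?_
  refine mul_le_mul_of_nonneg_right (Real.exp_le_exp.mpr ?_) (gammaFun_nonneg ht.le)
  nlinarith

theorem measurable_rfun : Measurable rfun := by
  have : rfun = fun x => ∫ t in Ioi (0 : ℝ), Real.exp (-(t * x)) * gammaFun t := funext rfun_eq
  rw [this]
  refine (StronglyMeasurable.integral_prod_right (f := fun x t : ℝ =>
    Real.exp (-(t * x)) * gammaFun t) ?_).measurable
  have := continuous_gammaFun
  exact Continuous.stronglyMeasurable (by unfold Function.uncurry; fun_prop)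

theorem integral_rfun_smul {E : Type*} [NormedAddCommGroup E] [NormedSpace ℝ E] [CompleteSpace E]
    {g : ℝ → E} {a B : ℝ} (ha : 0 < a)
    (hg : AEStronglyMeasurable g (volume.restrict (Ioi 0))) (hB : ∀ x, 0 < x → ‖g x‖ ≤ B) :
    IntegrableOn (fun x => rfun (a * x) • g x) (Ioi 0) ∧
    ∫ x in Ioi (0 : ℝ), rfun (a * x) • g x =
      ∫ t in Ioi (0 : ℝ), gammaFun t • ∫ x in Ioi (0 : ℝ), Real.exp (-(a * t * x)) • g x := by
  have hc := continuous_gammaFun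
  have hi : Integrable (fun p : ℝ × ℝ => Real.exp (-(p.2 * (a * p.1))) * gammaFun p.2)
      ((volume.restrict (Ioi 0)).prod (volume.restrict (Ioi 0))) := by
    rw [integrable_prod_iff' (Continuous.aestronglyMeasurable (by fun_prop))]
    have hexp : ∀ t ∈ Ioi (0 : ℝ), ∫ x in Ioi (0 : ℝ),
        ‖Real.exp (-(t * (a * x))) * gammaFun t‖ = a⁻¹ * (gammaFun t / t) := by
      intro t (ht : 0 < t)
      have : ∀ x : ℝ, ‖Real.exp (-(t * (a * x))) * gammaFun t‖ =
          Real.exp (-(t * a) * x) * gammaFun t := fun x => by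
        rw [Real.norm_eq_abs, abs_of_nonneg (mul_nonneg (Real.exp_pos _).le
          (gammaFun_nonneg ht.le))]
        ring_nf
      simp only [this]
      rw [integral_mul_const, integral_exp_mul_Ioi (by nlinarith)]
      simp
      field_simp
    constructor
    · refine (ae_restrict_iff' measurableSet_Ioi).mpr (ae_of_all _ fun t (ht : 0 < t) => ?_)
      refine Integrable.mul_const (f := fun x => Real.exp (-(t * (a * x)))) ?_ (gammaFun t)
      have := integrableOn_exp_mul_Ioi (a := -(t * a)) (by nlinarith) 0
      refine this.congr (ae_of_all _ fun x => ?_)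
      ring_nf
    · refine Integrable.congr (integrableOn_gammaFun_div.const_mul a⁻¹) ?_
      refine (ae_restrict_iff' measurableSet_Ioi).mpr (ae_of_all _ fun t ht => ?_)
      exact (hexp t ht).symm
  have hj : Integrable (fun p : ℝ × ℝ => (Real.exp (-(p.2 * (a * p.1))) * gammaFun p.2) • g p.1)
      ((volume.restrict (Ioi 0)).prod (volume.restrict (Ioi 0))) := by
    refine hi.smul_bdd B hg.comp_fst ?_
    have : ∀ᵐ x ∂(volume.restrict (Ioi (0 : ℝ))), ‖g x‖ ≤ B :=
      (ae_restrict_iff' measurableSet_Ioi).mpr (ae_of_all _ hB)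
    exact Measure.quasiMeasurePreserving_fst.ae this
  have e : ∀ x, rfun (a * x) • g x =
      ∫ t in Ioi (0 : ℝ), (Real.exp (-(t * (a * x))) * gammaFun t) • g x := fun x => by
    rw [integral_smul_const, ← rfun_eq]
  constructor
  · exact (hj.integral_prod_left).congr (ae_of_all _ fun x => (e x).symm)
  · simp only [e]
    rw [integral_integral_swap hj]
    refine integral_congr_ae (ae_of_all _ fun t => ?_)
    simp only []
    rw [← integral_smul]
    refine integral_congr_ae (ae_of_all _ fun x => ?_)
    simp only [smul_smul]
    ring_nf

/-! ### The kernel identity -/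

theorem integral_exp_smul_exp_I_mul {t : ℝ} (ht : 0 < t) (a : ℝ) (c : ℂ) :
    IntegrableOn (fun x : ℝ => Real.exp (-(t * x)) • (c * Complex.exp (Complex.I * a * x)))
      (Ioi 0) ∧
    ∫ x in Ioi (0 : ℝ), Real.exp (-(t * x)) • (c * Complex.exp (Complex.I * a * x)) =
      c * (t - Complex.I * a)⁻¹ := by
  have hre : (Complex.I * a - t : ℂ).re < 0 := by simpa using ht
  have e : (fun x : ℝ => Real.exp (-(t * x)) • (c * Complex.exp (Complex.I * a * x))) =
      fun x : ℝ => c * Complex.exp ((Complex.I * a - t) * x) := by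
    funext x
    rw [Complex.real_smul, Complex.ofReal_exp, mul_left_comm, ← Complex.exp_add]
    push_cast
    ring_nf
  rw [e]
  refine ⟨(integrableOn_exp_mul_complex_Ioi hre 0).const_mul c, ?_⟩
  rw [integral_const_mul, integral_exp_mul_complex_Ioi hre]
  simp only [Complex.ofReal_zero, mul_zero, Complex.exp_zero]
  rw [neg_div, ← div_neg, neg_sub, one_div]

theorem exp_I_mul_im (a x b : ℝ) :
    (Complex.exp ((b : ℝ) * Complex.I) * Complex.exp (Complex.I * a * x)).im =
      Real.sin (a * x + b) := by
  rw [← Complex.exp_add, show (b : ℂ) * Complex.I + Complex.I * a * x =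
    ((a * x + b : ℝ) : ℂ) * Complex.I by push_cast; ring, Complex.exp_ofReal_mul_I_im]

theorem integral_exp_mul_sin {s : ℝ} (hs : 0 < s) :
    IntegrableOn (fun x => Real.exp (-(s * x)) * Real.sin (x + π / 8)) (Ioi 0) ∧
    ∫ x in Ioi (0 : ℝ), Real.exp (-(s * x)) * Real.sin (x + π / 8) =
      (s * Real.sin (π / 8) + Real.cos (π / 8)) / (1 + s ^ 2) := by
  obtain ⟨hi, h⟩ := integral_exp_smul_exp_I_mul hs 1 (Complex.exp ((π / 8 : ℝ) * Complex.I))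
  have e : ∀ x : ℝ, RCLike.im (Real.exp (-(s * x)) • (Complex.exp ((π / 8 : ℝ) * Complex.I) *
      Complex.exp (Complex.I * (1 : ℝ) * x))) = Real.exp (-(s * x)) * Real.sin (x + π / 8) := by
    intro x
    rw [RCLike.im_eq_complex_im, Complex.real_smul, Complex.im_ofReal_mul, exp_I_mul_im, one_mul]
  constructor
  · exact hi.im.congr (ae_of_all _ e)
  · have h2 := congrArg Complex.im h
    rw [← RCLike.im_eq_complex_im, ← integral_im hi] at h2
    simp only [e] at h2
    rw [h2]
    have n2 : (s : ℂ) - Complex.I * (1 : ℝ) ≠ 0 := by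
      intro h; simpa using congrArg Complex.im h
    have n5 : (1 + (s : ℂ) ^ 2) ≠ 0 := by
      have : (1 + s ^ 2 : ℝ) ≠ 0 := by positivity
      exact_mod_cast this
    have f2 : ((s : ℂ) - Complex.I * (1 : ℝ))⁻¹ = (s + Complex.I) * (((1 + s ^ 2)⁻¹ : ℝ) : ℂ) := by
      push_cast
      rw [← div_eq_mul_inv, eq_div_iff n5, inv_mul_eq_iff_eq_mul₀ (by simpa using n2)]
      linear_combination Complex.I_sq
    rw [f2, ← mul_assoc, RCLike.im_eq_complex_im, Complex.im_mul_ofReal, div_eq_mul_inv]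
    congr 1
    rw [Complex.mul_im, Complex.exp_ofReal_mul_I_re, Complex.exp_ofReal_mul_I_im]
    simp
    ring

theorem integral_exp_mul_rfun {s : ℝ} (hs : 0 < s) :
    IntegrableOn (fun x => Real.exp (-(s * x)) * rfun x) (Ioi 0) ∧
    ∫ x in Ioi (0 : ℝ), Real.exp (-(s * x)) * rfun x =
      ∫ t in Ioi (0 : ℝ), gammaFun t / (t + s) := by
  obtain ⟨hi, h⟩ := integral_rfun_smul (g := fun x => Real.exp (-(s * x))) (B := 1) one_pos
    (Continuous.aestronglyMeasurable (by fun_prop)) (fun x hx => by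
      rw [Real.norm_eq_abs, abs_of_pos (Real.exp_pos _), Real.exp_le_one_iff]
      nlinarith)
  simp only [one_mul, smul_eq_mul, mul_comm (rfun _)] at hi h
  refine ⟨hi, h.trans (setIntegral_congr_fun measurableSet_Ioi fun t (ht : 0 < t) => ?_)⟩
  have e : ∀ x : ℝ, Real.exp (-(t * x)) * Real.exp (-(s * x)) = Real.exp (-(t + s) * x) :=
    fun x => by
      rw [← Real.exp_add]
      ring_nf
  simp only [e]
  rw [integral_exp_mul_Ioi (by linarith), mul_zero, Real.exp_zero, neg_div_neg_eq,
    mul_one_div]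

theorem integral_exp_mul_sin_sub_rfun {s : ℝ} (hs : 0 < s) :
    ∫ x in Ioi (0 : ℝ), Real.exp (-(s * x)) * (Real.sin (x + π / 8) - rfun x) =
      Real.sqrt 2 / 2 * Real.exp (etaF s) / (1 + s ^ 2) := by
  simp only [mul_sub]
  rw [integral_sub (integral_exp_mul_sin hs).1 (integral_exp_mul_rfun hs).1,
    (integral_exp_mul_sin hs).2, (integral_exp_mul_rfun hs).2, integral_gammaFun_div_add hs]
  ring

theorem norm_rfun_le {x : ℝ} (hx : 0 ≤ x) : ‖rfun x‖ ≤ rfun 0 := by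
  rw [Real.norm_eq_abs, abs_of_nonneg (rfun_nonneg x)]
  exact rfun_anti le_rfl hx

theorem integral_rfun_mul_sin_sub_rfun {a : ℝ} (ha : 0 < a) (ha1 : a ≠ 1) :
    IntegrableOn (fun x => rfun (a * x) * (Real.sin (x + π / 8) - rfun x)) (Ioi 0) ∧
    ∫ x in Ioi (0 : ℝ), rfun (a * x) * (Real.sin (x + π / 8) - rfun x) =
      (Complex.exp (etaExt (Real.log a + (π / 2 : ℝ) * Complex.I) -
        etaExt ((π / 2 : ℝ) * Complex.I))).im / (a ^ 2 - 1) := by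
  have hm := measurable_rfun
  obtain ⟨hi, h⟩ := integral_rfun_smul (g := fun x => Real.sin (x + π / 8) - rfun x)
    (B := 1 + rfun 0) ha (Measurable.aestronglyMeasurable (by fun_prop)) (fun x hx => by
      refine (norm_sub_le _ _).trans (add_le_add ?_ (norm_rfun_le hx.le))
      exact Real.abs_sin_le_one _)
  refine ⟨hi, h.trans ?_⟩
  have e : ∀ t ∈ Ioi (0 : ℝ), gammaFun t • ∫ x in Ioi (0 : ℝ), Real.exp (-(a * t * x)) •
      (Real.sin (x + π / 8) - rfun x) = 1 / (2 * π) *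
        (t * Real.exp (etaF (a * t) - etaF t) / ((1 + t ^ 2) * (1 + (a * t) ^ 2))) := by
    intro t (ht : 0 < t)
    simp only [smul_eq_mul]
    rw [integral_exp_mul_sin_sub_rfun (by positivity), gammaFun, sub_eq_add_neg, Real.exp_add]
    have h2 : Real.sqrt 2 * Real.sqrt 2 = 2 := Real.mul_self_sqrt (by norm_num)
    have n1 : 1 + t ^ 2 ≠ 0 := by positivity
    have n2 : 1 + (a * t) ^ 2 ≠ 0 := by positivity
    generalize 1 + t ^ 2 = A at *
    generalize 1 + (a * t) ^ 2 = B at *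
    have := Real.pi_ne_zero
    field_simp
    linear_combination h2
  rw [setIntegral_congr_fun measurableSet_Ioi e, integral_const_mul, integral_exp_etaF_sub ha ha1]
  have := Real.pi_ne_zero
  rw [← mul_assoc, mul_div_assoc', one_div_mul_cancel (by positivity)]
  ring

theorem integral_rfun_mul_sin {a : ℝ} (ha : 0 < a) (ha1 : a ≠ 1) :
    IntegrableOn (fun x => rfun x * Real.sin (a * x + π / 8)) (Ioi 0) ∧
    ∫ x in Ioi (0 : ℝ), rfun x * Real.sin (a * x + π / 8) =
      Real.sqrt 2 / (4 * (1 + a)) - Real.sqrt 2 / 2 * (Complex.exp ((π / 8 : ℝ) * Complex.I) *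
        Complex.exp (-etaExt (Real.log a + (π / 2 : ℝ) * Complex.I))).im / (1 - a) := by
  obtain ⟨hi, h⟩ := integral_rfun_smul (B := 1)
    (g := fun x : ℝ => Complex.exp ((π / 8 : ℝ) * Complex.I) * Complex.exp (Complex.I * a * x))
    one_pos (Continuous.aestronglyMeasurable (by fun_prop)) (fun x hx => by
      rw [← Complex.exp_add, show ((π / 8 : ℝ) : ℂ) * Complex.I + Complex.I * a * x =
        ((a * x + π / 8 : ℝ) : ℂ) * Complex.I by push_cast; ring, Complex.norm_exp_ofReal_mul_I])
  simp only [one_mul] at hi h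
  have e : ∀ x : ℝ, RCLike.im (rfun x • (Complex.exp ((π / 8 : ℝ) * Complex.I) *
      Complex.exp (Complex.I * a * x))) = rfun x * Real.sin (a * x + π / 8) := by
    intro x
    rw [RCLike.im_eq_complex_im, Complex.real_smul, Complex.im_ofReal_mul, exp_I_mul_im]
  have e2 : ∀ t ∈ Ioi (0 : ℝ), gammaFun t • ∫ x in Ioi (0 : ℝ), Real.exp (-(t * x)) •
      (Complex.exp ((π / 8 : ℝ) * Complex.I) * Complex.exp (Complex.I * a * x)) =
      Complex.exp ((π / 8 : ℝ) * Complex.I) * ((gammaFun t : ℂ) / (t - Complex.I * a)) := by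
    intro t (ht : 0 < t)
    rw [(integral_exp_smul_exp_I_mul ht a _).2, Complex.real_smul]
    ring
  refine ⟨hi.im.congr (ae_of_all _ e), ?_⟩
  have h2 := congrArg Complex.im h
  rw [← RCLike.im_eq_complex_im, ← integral_im hi] at h2
  simp only [e] at h2
  rw [h2, RCLike.im_eq_complex_im, setIntegral_congr_fun measurableSet_Ioi e2, integral_const_mul,
    integral_gammaFun_div_sub_I_mul ha ha1]
  generalize Complex.exp (-etaExt (Real.log a + (π / 2 : ℝ) * Complex.I)) = b
  have hne : (1 - a) ≠ 0 := sub_ne_zero.mpr ha1.symm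
  have hne2 : (1 + a) ≠ 0 := by positivity
  have hs : Real.sin (π / 8) * Real.cos (π / 8) = Real.sqrt 2 / 4 := by
    have := Real.sin_two_mul (π / 8)
    rw [show 2 * (π / 8) = π / 4 by ring, Real.sin_pi_div_four] at this
    linarith
  rw [mul_sub, Complex.sub_im]
  congr 1
  · rw [mul_div_assoc', show (1 - (a : ℂ) ^ 2) = ((1 - a ^ 2 : ℝ) : ℂ) by push_cast; rfl,
      Complex.div_ofReal_im, Complex.mul_im, Complex.exp_ofReal_mul_I_re,
      Complex.exp_ofReal_mul_I_im, show 1 - a ^ 2 = (1 - a) * (1 + a) by ring]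
    simp only [Complex.sub_re, Complex.sub_im, Complex.mul_re, Complex.mul_im, Complex.I_re,
      Complex.I_im, Complex.ofReal_re, Complex.ofReal_im]
    field_simp
    linear_combination 4 * (1 - a) * hs
  · rw [show Complex.exp ((π / 8 : ℝ) * Complex.I) * ((Real.sqrt 2 : ℝ) / 2 * b / (1 - (a : ℂ))) =
      ((Real.sqrt 2 / 2 / (1 - a) : ℝ) : ℂ) * (Complex.exp ((π / 8 : ℝ) * Complex.I) * b) by
        push_cast; ring, Complex.im_ofReal_mul]
    ring

theorem im_exp_etaExt_sub {a : ℝ} (ha : 0 < a) :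
    (Complex.exp (etaExt (Real.log a + (π / 2 : ℝ) * Complex.I) -
        etaExt ((π / 2 : ℝ) * Complex.I))).im =
      -((1 + a) * (Real.sqrt 2 / 2) * (Complex.exp ((π / 8 : ℝ) * Complex.I) *
        Complex.exp (-etaExt (Real.log a + (π / 2 : ℝ) * Complex.I))).im) := by
  have hπ := Real.pi_pos
  have hmem : (Real.log a : ℂ) + (π / 2 : ℝ) * Complex.I ∈ openStrip :=
    mem_openStrip_of_mem_Icc (by simp; linarith) (by simp; linarith)
  have h := exp_etaExt_mul_conj hmem
  rw [exp_log_add_pi_div_two_mul_I ha, show conj ((Real.log a : ℂ) + (π / 2 : ℝ) * Complex.I) +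
    π * Complex.I = (Real.log a : ℂ) + (π / 2 : ℝ) * Complex.I by
      rw [map_add, map_mul, Complex.conj_ofReal, Complex.conj_ofReal, Complex.conj_I]
      push_cast
      ring] at h
  rw [sub_eq_add_neg, Complex.exp_add, Complex.exp_neg (etaExt ((π / 2 : ℝ) * Complex.I)),
    exp_etaExt_pi_div_two_mul_I, Complex.exp_neg]
  have hP := Complex.exp_ne_zero (etaExt ((Real.log a : ℂ) + (π / 2 : ℝ) * Complex.I))
  generalize Complex.exp (etaExt ((Real.log a : ℂ) + (π / 2 : ℝ) * Complex.I)) = P at *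
  have hc : Complex.exp ((π / 8 : ℝ) * Complex.I) * conj (Complex.exp ((π / 8 : ℝ) * Complex.I)) =
      1 := by
    rw [Complex.mul_conj, Complex.normSq_eq_norm_sq, Complex.norm_exp_ofReal_mul_I]
    simp
  generalize Complex.exp ((π / 8 : ℝ) * Complex.I) = c at *
  have hP' : conj P ≠ 0 := by simpa using hP
  have hc0 : c ≠ 0 := left_ne_zero_of_mul_eq_one hc
  have h2 := ofReal_sqrt_two_sq
  have h20 := ofReal_sqrt_two_ne_zero
  have key : P * (Real.sqrt 2 * c)⁻¹ =
      (((1 + a) * (Real.sqrt 2 / 2) : ℝ) : ℂ) * conj (c * P⁻¹) := by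
    rw [map_mul, map_inv₀, ← div_eq_mul_inv, div_eq_iff (mul_ne_zero h20 hc0)]
    have h3 : (1 + (a : ℂ)) * (conj P)⁻¹ = P := by
      rw [mul_inv_eq_iff_eq_mul₀ hP', h]
      linear_combination (a : ℂ) * Complex.I_sq
    push_cast
    linear_combination -h3 + (-(1 + (a : ℂ)) * (conj P)⁻¹) * hc -
      (1 / 2 * (1 + (a : ℂ)) * (conj P)⁻¹ * c * conj c) * h2
  rw [key, Complex.im_ofReal_mul, Complex.conj_im]
  ring

theorem integral_kernel_one {a : ℝ} (ha : 0 < a) (ha1 : a ≠ 1) :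
    ∫ x in Ioi (0 : ℝ), (rfun x * Real.sin (a * x + π / 8) +
      rfun (a * x) * (Real.sin (x + π / 8) - rfun x)) = Real.sqrt 2 / (4 * (1 + a)) := by
  obtain ⟨i1, h1⟩ := integral_rfun_mul_sin ha ha1
  obtain ⟨i2, h2⟩ := integral_rfun_mul_sin_sub_rfun ha ha1
  rw [integral_add i1 i2, h1, h2, im_exp_etaExt_sub ha]
  generalize (Complex.im _) = y
  have hne : (1 - a) ≠ 0 := sub_ne_zero.mpr ha1.symm
  have hne2 : (1 + a) ≠ 0 := by positivity
  rw [show a ^ 2 - 1 = -((1 - a) * (1 + a)) by ring]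
  field_simp
  ring

theorem integral_kernel {l m : ℝ} (hl : 0 < l) (hm : 0 < m) (hlm : l ≠ m) :
    ∫ x in Ioi (0 : ℝ), (rfun (m * x) * Real.sin (l * x + π / 8) +
      rfun (l * x) * (Real.sin (m * x + π / 8) - rfun (m * x))) =
        Real.sqrt 2 / 4 / (l + m) := by
  have h := integral_comp_mul_left_Ioi (fun x => rfun x * Real.sin (l / m * x + π / 8) +
    rfun (l / m * x) * (Real.sin (x + π / 8) - rfun x)) 0 hm
  rw [mul_zero, integral_kernel_one (by positivity) (by
    rw [Ne, div_eq_one_iff_eq hm.ne']; exact hlm)] at h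
  have e : ∀ x : ℝ, l / m * (m * x) = l * x := fun x => by field_simp
  simp only [e] at h
  rw [h, smul_eq_mul]
  field_simp
  ring

/-! ### Abel regularization of the sine part -/

theorem integral_exp_mul_cos {t : ℝ} (ht : 0 < t) (a b : ℝ) :
    IntegrableOn (fun x => Real.exp (-(t * x)) * Real.cos (a * x + b)) (Ioi 0) ∧
    ∫ x in Ioi (0 : ℝ), Real.exp (-(t * x)) * Real.cos (a * x + b) =
      (t * Real.cos b - a * Real.sin b) / (t ^ 2 + a ^ 2) := by
  obtain ⟨hi, h⟩ := integral_exp_smul_exp_I_mul ht a (Complex.exp ((b : ℝ) * Complex.I))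
  have e : ∀ x : ℝ, RCLike.re (Real.exp (-(t * x)) • (Complex.exp ((b : ℝ) * Complex.I) *
      Complex.exp (Complex.I * a * x))) = Real.exp (-(t * x)) * Real.cos (a * x + b) := by
    intro x
    rw [RCLike.re_eq_complex_re, Complex.real_smul, Complex.re_ofReal_mul, ← Complex.exp_add,
      show (b : ℂ) * Complex.I + Complex.I * a * x = ((a * x + b : ℝ) : ℂ) * Complex.I by
        push_cast; ring, Complex.exp_ofReal_mul_I_re]
  refine ⟨hi.re.congr (ae_of_all _ e), ?_⟩
  have h2 := congrArg Complex.re h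
  rw [← RCLike.re_eq_complex_re, ← integral_re hi] at h2
  simp only [e] at h2
  rw [h2, RCLike.re_eq_complex_re]
  have n2 : (t : ℂ) - Complex.I * a ≠ 0 := by
    intro h; have := congrArg Complex.re h; simp at this; exact ht.ne' this
  have n5 : ((t : ℂ) ^ 2 + (a : ℂ) ^ 2) ≠ 0 := by
    have : (t ^ 2 + a ^ 2 : ℝ) ≠ 0 := by positivity
    exact_mod_cast this
  have f2 : ((t : ℂ) - Complex.I * a)⁻¹ = (t + Complex.I * a) * (((t ^ 2 + a ^ 2)⁻¹ : ℝ) : ℂ) := by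
    push_cast
    rw [← div_eq_mul_inv, eq_div_iff n5, inv_mul_eq_iff_eq_mul₀ n2]
    linear_combination (a : ℂ) ^ 2 * Complex.I_sq
  rw [f2, ← mul_assoc, Complex.re_mul_ofReal, div_eq_mul_inv]
  congr 1
  rw [Complex.mul_re, Complex.exp_ofReal_mul_I_re, Complex.exp_ofReal_mul_I_im]
  simp
  ring

theorem integral_exp_mul_sin_mul_sin {t : ℝ} (ht : 0 < t) (l m : ℝ) :
    ∫ x in Ioi (0 : ℝ), Real.exp (-(t * x)) * (Real.sin (l * x + π / 8) *
        Real.sin (m * x + π / 8)) =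
      1 / 2 * (t / (t ^ 2 + (l - m) ^ 2)) -
        Real.sqrt 2 / 4 * ((t - (l + m)) / (t ^ 2 + (l + m) ^ 2)) := by
  obtain ⟨i1, h1⟩ := integral_exp_mul_cos ht (l - m) 0
  obtain ⟨i2, h2⟩ := integral_exp_mul_cos ht (l + m) (π / 4)
  have e : ∀ x : ℝ, Real.exp (-(t * x)) * (Real.sin (l * x + π / 8) * Real.sin (m * x + π / 8)) =
      1 / 2 * (Real.exp (-(t * x)) * Real.cos ((l - m) * x + 0) -
        Real.exp (-(t * x)) * Real.cos ((l + m) * x + π / 4)) := fun x => by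
    have e1 := Real.cos_sub (l * x + π / 8) (m * x + π / 8)
    have e2 := Real.cos_add (l * x + π / 8) (m * x + π / 8)
    rw [show (l * x + π / 8) - (m * x + π / 8) = (l - m) * x + 0 by ring] at e1
    rw [show (l * x + π / 8) + (m * x + π / 8) = (l + m) * x + π / 4 by ring] at e2
    rw [e1, e2]
    ring
  simp only [e]
  rw [integral_const_mul, integral_sub i1 i2, h1, h2, Real.cos_pi_div_four, Real.sin_pi_div_four]
  simp
  ring

/-- Fubini for quadratic forms whose kernel is dominated on the support of `f`. -/
theorem integral_quadratic {f G : ℝ → ℝ} {k : ℝ → ℝ × ℝ → ℝ} {α : ℝ} {μ : Measure ℝ} [SFinite μ]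
    (hf : Integrable f μ) (hα : ∀ l, f l ≠ 0 → α ≤ l) (hk : Measurable (Function.uncurry k))
    (hG : IntegrableOn G (Ioi 0))
    (hkG : ∀ x, 0 < x → ∀ p : ℝ × ℝ, α ≤ p.1 → α ≤ p.2 → |k x p| ≤ G x) :
    IntegrableOn (fun x => ∫ p, f p.1 * f p.2 * k x p ∂μ.prod μ) (Ioi 0) ∧
    ∫ x in Ioi (0 : ℝ), ∫ p, f p.1 * f p.2 * k x p ∂μ.prod μ =
      ∫ p, f p.1 * f p.2 * (∫ x in Ioi (0 : ℝ), k x p) ∂μ.prod μ := by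
  have hff : Integrable (fun p : ℝ × ℝ => f p.1 * f p.2) (μ.prod μ) := hf.mul_prod hf
  have hi : Integrable (fun q : ℝ × (ℝ × ℝ) => f q.2.1 * f q.2.2 * k q.1 q.2)
      ((volume.restrict (Ioi 0)).prod (μ.prod μ)) := by
    have hd := hG.mul_prod hff
    refine hd.mono (hff.aestronglyMeasurable.comp_snd.mul hk.aestronglyMeasurable) ?_
    have hx : ∀ᵐ q ∂((volume.restrict (Ioi (0 : ℝ))).prod (μ.prod μ)), 0 < q.1 :=
      Measure.quasiMeasurePreserving_fst.ae (ae_restrict_mem measurableSet_Ioi)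
    filter_upwards [hx] with q hq
    rw [norm_mul, norm_mul (G q.1), mul_comm]
    by_cases h : f q.2.1 * f q.2.2 = 0
    · simp [h]
    · refine mul_le_mul_of_nonneg_right ?_ (norm_nonneg _)
      exact (hkG q.1 hq q.2 (hα _ (left_ne_zero_of_mul h)) (hα _ (right_ne_zero_of_mul h))).trans
        (le_abs_self _)
  refine ⟨hi.integral_prod_left, ?_⟩
  rw [integral_integral_swap hi]
  simp only [integral_const_mul]

theorem sq_setIntegral_eq (g : ℝ → ℝ) (f : ℝ → ℝ) :
    (∫ l in Ioi (0 : ℝ), f l * g l) ^ 2 = ∫ p, f p.1 * f p.2 * (g p.1 * g p.2)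
      ∂(volume.restrict (Ioi (0 : ℝ))).prod (volume.restrict (Ioi 0)) := by
  rw [sq, ← integral_prod_mul]
  refine integral_congr_ae (ae_of_all _ fun p => ?_)
  simp only []
  ring

theorem integral_exp_mul_sq {f : ℝ → ℝ} {α : ℝ} (hf : IntegrableOn f (Ioi 0))
    (hα : ∀ l, f l ≠ 0 → α ≤ l) {t : ℝ} (ht : 0 < t) :
    IntegrableOn (fun x => Real.exp (-(t * x)) *
      (∫ l in Ioi (0 : ℝ), f l * Real.sin (l * x + π / 8)) ^ 2) (Ioi 0) ∧
    ∫ x in Ioi (0 : ℝ), Real.exp (-(t * x)) *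
      (∫ l in Ioi (0 : ℝ), f l * Real.sin (l * x + π / 8)) ^ 2 =
      ∫ p, f p.1 * f p.2 * (1 / 2 * (t / (t ^ 2 + (p.1 - p.2) ^ 2)) -
        Real.sqrt 2 / 4 * ((t - (p.1 + p.2)) / (t ^ 2 + (p.1 + p.2) ^ 2)))
        ∂(volume.restrict (Ioi 0)).prod (volume.restrict (Ioi 0)) := by
  have hG : IntegrableOn (fun x => Real.exp (-(t * x))) (Ioi 0) := by
    have := integrableOn_exp_mul_Ioi (a := -t) (by linarith) 0
    simpa only [neg_mul] using this
  obtain ⟨hi, h⟩ := integral_quadratic (f := f) (α := α) (μ := volume.restrict (Ioi 0))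
    (G := fun x => Real.exp (-(t * x))) (k := fun x p => Real.exp (-(t * x)) *
      (Real.sin (p.1 * x + π / 8) * Real.sin (p.2 * x + π / 8))) hf hα
      (Continuous.measurable (by unfold Function.uncurry; fun_prop)) hG (fun x hx p _ _ => by
        rw [abs_mul, abs_mul, abs_of_pos (Real.exp_pos _)]
        exact mul_le_of_le_one_right (Real.exp_pos _).le
          (mul_le_one₀ (Real.abs_sin_le_one _) (abs_nonneg _) (Real.abs_sin_le_one _)))
  simp only [integral_exp_mul_sin_mul_sin ht] at h
  have e : ∀ x, ∫ p, f p.1 * f p.2 * (Real.exp (-(t * x)) *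
      (Real.sin (p.1 * x + π / 8) * Real.sin (p.2 * x + π / 8)))
        ∂(volume.restrict (Ioi 0)).prod (volume.restrict (Ioi 0)) =
      Real.exp (-(t * x)) * (∫ l in Ioi (0 : ℝ), f l * Real.sin (l * x + π / 8)) ^ 2 := ?_
  · simp only [e] at hi h
    exact ⟨hi, h⟩
  intro x
  rw [sq_setIntegral_eq (fun l => Real.sin (l * x + π / 8)) f, ← integral_const_mul]
  refine integral_congr_ae (ae_of_all _ fun p => ?_)
  simp only []
  ring

theorem integrable_quadratic {f : ℝ → ℝ} {k : ℝ × ℝ → ℝ} {α B : ℝ} {μ : Measure ℝ} [SFinite μ]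
    (hf : Integrable f μ) (hα : ∀ l, f l ≠ 0 → α ≤ l) (hk : Measurable k)
    (hB : ∀ p : ℝ × ℝ, α ≤ p.1 → α ≤ p.2 → |k p| ≤ B) :
    Integrable (fun p => f p.1 * f p.2 * k p) (μ.prod μ) := by
  have hff : Integrable (fun p : ℝ × ℝ => f p.1 * f p.2) (μ.prod μ) := hf.mul_prod hf
  refine (hff.mul_const B).mono (hff.aestronglyMeasurable.mul hk.aestronglyMeasurable)
    (ae_of_all _ fun p => ?_)
  rw [norm_mul, norm_mul (f p.1 * f p.2)]
  by_cases h : f p.1 * f p.2 = 0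
  · simp [h]
  · exact mul_le_mul_of_nonneg_left ((hB p (hα _ (left_ne_zero_of_mul h))
      (hα _ (right_ne_zero_of_mul h))).trans (le_abs_self _)) (norm_nonneg _)

theorem tendsto_poisson {f : ℝ → ℝ} {α : ℝ} (hfc : Continuous f) (hfs : HasCompactSupport f)
    (hα0 : 0 < α) (hα : ∀ l, f l ≠ 0 → α ≤ l) :
    Tendsto (fun t => ∫ p, f p.1 * f p.2 * (t / (t ^ 2 + (p.1 - p.2) ^ 2))
        ∂(volume.restrict (Ioi 0)).prod (volume.restrict (Ioi 0))) (𝓝[>] 0)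
      (𝓝 (π * ∫ l in Ioi (0 : ℝ), f l ^ 2)) := by
  have hfi : Integrable f := hfc.integrable_of_hasCompactSupport hfs
  obtain ⟨B, hB⟩ := hfs.exists_bound_of_continuous hfc
  have hB0 : 0 ≤ B := (norm_nonneg _).trans (hB 0)
  have hq : Integrable (fun u : ℝ => (1 + u ^ 2)⁻¹) := integrable_inv_one_add_sq
  have hm : ∀ t : ℝ, AEStronglyMeasurable (fun q : ℝ × ℝ => f q.1 * (f (q.1 + t * q.2) *
      (1 + q.2 ^ 2)⁻¹)) ((volume.restrict (Ioi 0)).prod volume) := fun t =>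
    Measurable.aestronglyMeasurable (by have := hfc.measurable; fun_prop)
  have hd : Integrable (fun q : ℝ × ℝ => f q.1 * (B * (1 + q.2 ^ 2)⁻¹))
      ((volume.restrict (Ioi 0)).prod volume) := hfi.integrableOn.mul_prod (hq.const_mul B)
  have hle : ∀ (t : ℝ) (q : ℝ × ℝ), ‖f q.1 * (f (q.1 + t * q.2) * (1 + q.2 ^ 2)⁻¹)‖ ≤
      ‖f q.1 * (B * (1 + q.2 ^ 2)⁻¹)‖ := by
    intro t q
    have h1 : 0 ≤ (1 + q.2 ^ 2)⁻¹ := by positivity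
    rw [norm_mul, norm_mul, norm_mul, norm_mul, Real.norm_of_nonneg hB0]
    gcongr
    exact hB _
  have hcongr : ∀ t : ℝ, 0 < t → ∫ q, f q.1 * (f (q.1 + t * q.2) * (1 + q.2 ^ 2)⁻¹)
      ∂(volume.restrict (Ioi 0)).prod volume = ∫ p, f p.1 * f p.2 * (t / (t ^ 2 + (p.1 - p.2) ^ 2))
        ∂(volume.restrict (Ioi 0)).prod (volume.restrict (Ioi 0)) := by
    intro t ht
    rw [integral_prod _ (hd.mono (hm t) (ae_of_all _ (hle t))), integral_prod]
    · refine integral_congr_ae (ae_of_all _ fun l => ?_)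
      simp only []
      rw [setIntegral_eq_integral_of_forall_compl_eq_zero (fun m hm => by
        have : f m = 0 := by
          by_contra h
          exact hm (hα0.trans_le (hα m h))
        simp [this])]
      have c1 := Measure.integral_comp_mul_left
        (fun v => f l * f (l + v) * (t / (t ^ 2 + (l - (l + v)) ^ 2))) t
      rw [integral_add_left_eq_self (fun m => f l * f m * (t / (t ^ 2 + (l - m) ^ 2))) l,
        abs_of_pos (inv_pos.mpr ht), smul_eq_mul, eq_inv_mul_iff_mul_eq₀ ht.ne',
        ← integral_const_mul] at c1
      rw [← c1]
      refine integral_congr_ae (ae_of_all _ fun u => ?_)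
      have : 1 + u ^ 2 ≠ 0 := by positivity
      have : t ^ 2 + (l - (l + t * u)) ^ 2 ≠ 0 := by positivity
      simp only []
      rw [show t ^ 2 + (l - (l + t * u)) ^ 2 = t ^ 2 * (1 + u ^ 2) by ring]
      field_simp
    · refine integrable_quadratic (B := t / t ^ 2) hfi.integrableOn hα (by fun_prop)
        fun p _ _ => ?_
      rw [abs_of_nonneg (by positivity)]
      gcongr
      nlinarith [sq_nonneg (p.1 - p.2)]
  have hlim : π * ∫ l in Ioi (0 : ℝ), f l ^ 2 = ∫ q, f q.1 * (f (q.1 + 0 * q.2) * (1 + q.2 ^ 2)⁻¹)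
      ∂(volume.restrict (Ioi 0)).prod volume := by
    rw [mul_comm, ← integral_univ_inv_one_add_sq, ← integral_prod_mul]
    refine integral_congr_ae (ae_of_all _ fun q => ?_)
    simp only [zero_mul, add_zero]
    ring
  rw [hlim]
  refine Tendsto.congr' (f₁ := fun t => ∫ q, f q.1 * (f (q.1 + t * q.2) * (1 + q.2 ^ 2)⁻¹)
      ∂(volume.restrict (Ioi 0)).prod volume) ?_ ?_
  · filter_upwards [self_mem_nhdsWithin] with t ht
    exact hcongr t ht
  · refine tendsto_integral_filter_of_dominated_convergence _ (Eventually.of_forall hm)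
      (Eventually.of_forall fun t => ae_of_all _ (hle t)) hd.norm (ae_of_all _ fun q => ?_)
    refine tendsto_nhdsWithin_of_tendsto_nhds (ContinuousAt.tendsto (x := (0 : ℝ)) ?_)
    fun_prop

theorem abs_sub_div_sq_add_sq_le {α s : ℝ} (hα : 0 < α) (hs : 2 * α ≤ s) (t : ℝ) :
    |(t - s) / (t ^ 2 + s ^ 2)| ≤ 1 / α := by
  have hpos : 0 < t ^ 2 + s ^ 2 := by nlinarith [sq_nonneg t]
  rw [abs_div, abs_of_pos hpos, div_le_div_iff₀ hpos hα, one_mul]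
  rcases abs_cases (t - s) with ⟨h, _⟩ | ⟨h, _⟩ <;> rw [h] <;>
    nlinarith [sq_nonneg (t - s), sq_nonneg (t + s), sq_nonneg t]

theorem tendsto_integral_div_add {f : ℝ → ℝ} {α : ℝ} {μ : Measure ℝ} [SFinite μ]
    (hf : Integrable f μ) (hα0 : 0 < α) (hα : ∀ l, f l ≠ 0 → α ≤ l) :
    Tendsto (fun t : ℝ => ∫ p, f p.1 * f p.2 * ((t - (p.1 + p.2)) / (t ^ 2 + (p.1 + p.2) ^ 2))
        ∂μ.prod μ) (𝓝[>] 0) (𝓝 (∫ p, f p.1 * f p.2 * (-(1 / (p.1 + p.2))) ∂μ.prod μ)) := by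
  have hff : Integrable (fun p : ℝ × ℝ => f p.1 * f p.2) (μ.prod μ) := hf.mul_prod hf
  refine tendsto_integral_filter_of_dominated_convergence _
    (Eventually.of_forall fun t => hff.aestronglyMeasurable.mul
      (Measurable.aestronglyMeasurable (by fun_prop)))
    (Eventually.of_forall fun t => ae_of_all _ fun p => ?_) (hff.norm.mul_const (1 / α))
    (ae_of_all _ fun p => ?_)
  · rw [norm_mul]
    by_cases h : f p.1 * f p.2 = 0
    · simp [h]
    · have h1 := hα _ (left_ne_zero_of_mul h)
      have h2 := hα _ (right_ne_zero_of_mul h)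
      exact mul_le_mul_of_nonneg_left (abs_sub_div_sq_add_sq_le hα0 (by linarith) t)
        (norm_nonneg _)
  · by_cases h : f p.1 * f p.2 = 0
    · simp [h]
    · have h1 := hα _ (left_ne_zero_of_mul h)
      have h2 := hα _ (right_ne_zero_of_mul h)
      have hs : 0 < p.1 + p.2 := by linarith
      have : -(1 / (p.1 + p.2)) = (0 - (p.1 + p.2)) / (0 ^ 2 + (p.1 + p.2) ^ 2) := by
        field_simp
        ring
      rw [this]
      refine tendsto_nhdsWithin_of_tendsto_nhds (ContinuousAt.tendsto (x := (0 : ℝ)) ?_)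
      refine continuousAt_const.mul (ContinuousAt.div (by fun_prop) (by fun_prop) ?_)
      positivity

theorem integrable_and_integral_of_tendsto_exp_mul {h : ℝ → ℝ} {L : ℝ}
    (hm : AEStronglyMeasurable h (volume.restrict (Ioi 0))) (h0 : ∀ x, 0 ≤ h x)
    (hi : ∀ t, 0 < t → IntegrableOn (fun x => Real.exp (-(t * x)) * h x) (Ioi 0))
    (hL : Tendsto (fun t : ℝ => ∫ x in Ioi (0 : ℝ), Real.exp (-(t * x)) * h x) (𝓝[>] 0) (𝓝 L)) :
    IntegrableOn h (Ioi 0) ∧ ∫ x in Ioi (0 : ℝ), h x = L := by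
  have hlim : ∀ x : ℝ, Tendsto (fun t : ℝ => Real.exp (-(t * x)) * h x) (𝓝[>] 0) (𝓝 (h x)) := by
    intro x
    have : h x = Real.exp (-(0 * x)) * h x := by simp
    nth_rewrite 2 [this]
    refine tendsto_nhdsWithin_of_tendsto_nhds (ContinuousAt.tendsto (x := (0 : ℝ)) ?_)
    fun_prop
  have hint : IntegrableOn h (Ioi 0) := by
    have hu : Tendsto (fun n : ℕ => 1 / ((n : ℝ) + 1)) atTop (𝓝[>] 0) :=
      tendsto_nhdsWithin_iff.mpr ⟨tendsto_one_div_add_atTop_nhds_zero_nat,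
        Eventually.of_forall fun n => by simp only [mem_Ioi]; positivity⟩
    refine ⟨hm, ?_⟩
    rw [hasFiniteIntegral_iff_ofReal (ae_of_all _ h0)]
    have hF := lintegral_liminf_le' (u := atTop) (μ := volume.restrict (Ioi (0 : ℝ)))
      (f := fun (n : ℕ) x => ENNReal.ofReal (Real.exp (-(1 / ((n : ℝ) + 1) * x)) * h x))
      (fun n => (hi _ (by positivity)).aestronglyMeasurable.aemeasurable.ennreal_ofReal)
    have e1 : ∀ x, liminf (fun n : ℕ => ENNReal.ofReal (Real.exp (-(1 / ((n : ℝ) + 1) * x)) * h x))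
        atTop = ENNReal.ofReal (h x) := fun x =>
      (ENNReal.tendsto_ofReal ((hlim x).comp hu)).liminf_eq
    have e2 : ∀ n : ℕ, ∫⁻ x in Ioi (0 : ℝ), ENNReal.ofReal (Real.exp (-(1 / ((n : ℝ) + 1) * x)) *
        h x) = ENNReal.ofReal (∫ x in Ioi (0 : ℝ), Real.exp (-(1 / ((n : ℝ) + 1) * x)) * h x) :=
      fun n => (ofReal_integral_eq_lintegral_ofReal (hi _ (by positivity))
        (ae_of_all _ fun x => mul_nonneg (Real.exp_pos _).le (h0 x))).symm
    simp only [e1, e2] at hF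
    have e3 := (ENNReal.tendsto_ofReal (hL.comp hu)).liminf_eq
    simp only [Function.comp_apply] at e3
    exact (hF.trans_eq e3).trans_lt ENNReal.ofReal_lt_top
  refine ⟨hint, tendsto_nhds_unique ?_ hL⟩
  refine tendsto_integral_filter_of_dominated_convergence _
    (eventually_nhdsWithin_of_forall fun t ht => (hi t ht).aestronglyMeasurable)
    (eventually_nhdsWithin_of_forall fun t (ht : 0 < t) => ?_) hint (ae_of_all _ hlim)
  filter_upwards [ae_restrict_mem measurableSet_Ioi] with x (hx : 0 < x)
  rw [Real.norm_of_nonneg (mul_nonneg (Real.exp_pos _).le (h0 x))]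
  refine mul_le_of_le_one_left (h0 x) (Real.exp_le_one_iff.mpr ?_)
  nlinarith

theorem measurable_setIntegral_mul {f g : ℝ → ℝ} (hf : Measurable f) (hg : Measurable g) :
    Measurable fun x => ∫ l in Ioi (0 : ℝ), f l * g (l * x) := by
  refine (StronglyMeasurable.integral_prod_right (f := fun x l : ℝ => f l * g (l * x))
    (Measurable.stronglyMeasurable ?_)).measurable
  unfold Function.uncurry
  fun_prop

/-- The Plancherel formula for the sine part of the eigenfunction expansion. -/
theorem integral_sq_sin {f : ℝ → ℝ} {α : ℝ} (hfc : Continuous f) (hfs : HasCompactSupport f)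
    (hα0 : 0 < α) (hα : ∀ l, f l ≠ 0 → α ≤ l) :
    IntegrableOn (fun x => (∫ l in Ioi (0 : ℝ), f l * Real.sin (l * x + π / 8)) ^ 2) (Ioi 0) ∧
    ∫ x in Ioi (0 : ℝ), (∫ l in Ioi (0 : ℝ), f l * Real.sin (l * x + π / 8)) ^ 2 =
      π / 2 * (∫ l in Ioi (0 : ℝ), f l ^ 2) + ∫ p, f p.1 * f p.2 * (Real.sqrt 2 / 4 / (p.1 + p.2))
        ∂(volume.restrict (Ioi 0)).prod (volume.restrict (Ioi 0)) := by
  have hfi : IntegrableOn f (Ioi 0) := (hfc.integrable_of_hasCompactSupport hfs).integrableOn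
  refine integrable_and_integral_of_tendsto_exp_mul
    ((measurable_setIntegral_mul (g := fun y => Real.sin (y + π / 8)) hfc.measurable
      (by fun_prop)).pow_const 2).aestronglyMeasurable (fun x => sq_nonneg _)
    (fun t ht => (integral_exp_mul_sq hfi hα ht).1) ?_
  have hlim := ((tendsto_poisson hfc hfs hα0 hα).const_mul (1 / 2)).sub
    ((tendsto_integral_div_add hfi hα0 hα).const_mul (Real.sqrt 2 / 4))
  have e : 1 / 2 * (π * ∫ l in Ioi (0 : ℝ), f l ^ 2) - Real.sqrt 2 / 4 *
      (∫ p, f p.1 * f p.2 * (-(1 / (p.1 + p.2)))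
        ∂(volume.restrict (Ioi (0 : ℝ))).prod (volume.restrict (Ioi 0))) =
      π / 2 * (∫ l in Ioi (0 : ℝ), f l ^ 2) + ∫ p, f p.1 * f p.2 * (Real.sqrt 2 / 4 / (p.1 + p.2))
        ∂(volume.restrict (Ioi 0)).prod (volume.restrict (Ioi 0)) := by
    rw [sub_eq_add_neg, ← neg_mul, ← integral_const_mul (-(Real.sqrt 2 / 4))]
    congr 1
    · ring
    · refine integral_congr_ae (ae_of_all _ fun p => ?_)
      simp only []
      ring
  rw [e] at hlim
  refine hlim.congr' ?_
  filter_upwards [self_mem_nhdsWithin] with t (ht : 0 < t)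
  rw [(integral_exp_mul_sq hfi hα ht).2, ← integral_const_mul, ← integral_const_mul,
    ← integral_sub]
  · refine integral_congr_ae (ae_of_all _ fun p => ?_)
    simp only []
    ring
  · refine Integrable.const_mul (integrable_quadratic (B := t / t ^ 2) hfi hα (by fun_prop)
      fun p _ _ => ?_) _
    rw [abs_of_nonneg (by positivity)]
    gcongr
    nlinarith [sq_nonneg (p.1 - p.2)]
  · refine Integrable.const_mul (integrable_quadratic (B := 1 / α) hfi hα (by fun_prop)
      fun p h1 h2 => ?_) _
    exact abs_sub_div_sq_add_sq_le hα0 (by linarith) t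

theorem PiT_eq {f : ℝ → ℝ} {x : ℝ} (hx : 0 < x) :
    PiT f x = ∫ l in Ioi (0 : ℝ), f l * (Real.sin (l * x + π / 8) - rfun (l * x)) := by
  refine setIntegral_congr_fun measurableSet_Ioi fun l (hl : 0 < l) => ?_
  simp only [psiOne]
  rw [if_pos (by positivity)]

theorem measurable_psiOne : Measurable psiOne := by
  have := measurable_rfun
  exact Measurable.ite measurableSet_Ioi (by fun_prop) measurable_const

theorem abs_psiOne_le (x : ℝ) : |psiOne x| ≤ 1 + rfun 0 := by
  unfold psiOne
  split_ifs with h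
  · refine (abs_sub _ _).trans (add_le_add (Real.abs_sin_le_one _) ?_)
    exact norm_rfun_le h.le
  · simpa using add_nonneg zero_le_one (rfun_nonneg 0)

theorem PiT_add {f g : ℝ → ℝ} (hf : Integrable f) (hg : Integrable g) (x : ℝ) :
    PiT (fun l => f l + g l) x = PiT f x + PiT g x := by
  have hm := measurable_psiOne
  have key : ∀ h : ℝ → ℝ, Integrable h →
      IntegrableOn (fun l => h l * psiOne (l * x)) (Ioi 0) := fun h hh =>
    hh.integrableOn.mul_bdd (Measurable.aestronglyMeasurable (by fun_prop))
      (ae_of_all _ fun l => abs_psiOne_le _)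
  rw [PiT, PiT, PiT, ← integral_add (key f hf) (key g hg)]
  simp only [add_mul]

theorem integral_sq_sin_sub_sq_PiT {f : ℝ → ℝ} {α : ℝ} (hfi : IntegrableOn f (Ioi 0))
    (hα0 : 0 < α) (hα : ∀ l, f l ≠ 0 → α ≤ l) :
    IntegrableOn (fun x => (∫ l in Ioi (0 : ℝ), f l * Real.sin (l * x + π / 8)) ^ 2 -
      PiT f x ^ 2) (Ioi 0) ∧
    ∫ x in Ioi (0 : ℝ), ((∫ l in Ioi (0 : ℝ), f l * Real.sin (l * x + π / 8)) ^ 2 -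
      PiT f x ^ 2) = ∫ p, f p.1 * f p.2 * (Real.sqrt 2 / 4 / (p.1 + p.2))
        ∂(volume.restrict (Ioi 0)).prod (volume.restrict (Ioi 0)) := by
  have hm := measurable_rfun
  set k : ℝ → ℝ × ℝ → ℝ := fun x p => rfun (p.2 * x) * Real.sin (p.1 * x + π / 8) +
    rfun (p.1 * x) * (Real.sin (p.2 * x + π / 8) - rfun (p.2 * x)) with hk
  have hG : IntegrableOn (fun x => rfun (α * x) * (2 + rfun 0)) (Ioi 0) := by
    have := (integral_rfun_smul (E := ℝ) (g := fun _ => 1) (B := 1) hα0 (by fun_prop)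
      (by simp)).1
    simp only [smul_eq_mul, mul_one] at this
    exact this.mul_const _
  obtain ⟨hi, h⟩ := integral_quadratic (μ := volume.restrict (Ioi 0)) (k := k) hfi hα
    (by rw [hk]; unfold Function.uncurry; fun_prop) hG (fun x hx p h1 h2 => by
      have b1 := rfun_anti (by positivity) (mul_le_mul_of_nonneg_right h1 hx.le)
      have b2 := rfun_anti (by positivity) (mul_le_mul_of_nonneg_right h2 hx.le)
      have b3 := rfun_anti le_rfl (show 0 ≤ p.2 * x by nlinarith)
      have n1 := rfun_nonneg (p.1 * x)
      have n2 := rfun_nonneg (p.2 * x)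
      have n3 := rfun_nonneg 0
      have n4 := rfun_nonneg (α * x)
      have s1 := Real.abs_sin_le_one (p.1 * x + π / 8)
      have s2 := Real.abs_sin_le_one (p.2 * x + π / 8)
      calc |k x p| ≤ rfun (p.2 * x) * |Real.sin (p.1 * x + π / 8)| +
            rfun (p.1 * x) * (|Real.sin (p.2 * x + π / 8)| + rfun (p.2 * x)) := by
            refine (abs_add_le _ _).trans ?_
            rw [abs_mul, abs_mul, abs_of_nonneg n1, abs_of_nonneg n2]
            gcongr
            refine (abs_sub _ _).trans ?_
            rw [abs_of_nonneg n2]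
        _ ≤ rfun (α * x) * 1 + rfun (α * x) * (1 + rfun 0) := by gcongr
        _ = _ := by ring)
  have e : ∀ x ∈ Ioi (0 : ℝ), ∫ p, f p.1 * f p.2 * k x p
      ∂(volume.restrict (Ioi (0 : ℝ))).prod (volume.restrict (Ioi 0)) =
      (∫ l in Ioi (0 : ℝ), f l * Real.sin (l * x + π / 8)) ^ 2 - PiT f x ^ 2 := by
    intro x (hx : 0 < x)
    rw [PiT_eq hx, sq_setIntegral_eq (fun l => Real.sin (l * x + π / 8)) f,
      sq_setIntegral_eq (fun l => Real.sin (l * x + π / 8) - rfun (l * x)) f, ← integral_sub]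
    · refine integral_congr_ae (ae_of_all _ fun p => ?_)
      simp only [hk]
      ring
    · refine integrable_quadratic (B := 1) hfi hα (by fun_prop) fun p _ _ => ?_
      rw [abs_mul]
      exact mul_le_one₀ (Real.abs_sin_le_one _) (abs_nonneg _) (Real.abs_sin_le_one _)
    · refine integrable_quadratic (B := (1 + rfun 0) * (1 + rfun 0)) hfi hα (by fun_prop)
        fun p h1 h2 => ?_
      have n3 := rfun_nonneg 0
      have key : ∀ l, α ≤ l → |Real.sin (l * x + π / 8) - rfun (l * x)| ≤ 1 + rfun 0 :=
        fun l hl => (abs_sub _ _).trans (add_le_add (Real.abs_sin_le_one _)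
          (norm_rfun_le (mul_nonneg (hα0.le.trans hl) hx.le)))
      rw [abs_mul]
      exact mul_le_mul (key _ h1) (key _ h2) (abs_nonneg _) (by positivity)
  refine ⟨hi.congr_fun e measurableSet_Ioi, ?_⟩
  rw [← setIntegral_congr_fun measurableSet_Ioi e, h]
  have hne : ∀ᵐ p ∂(volume.restrict (Ioi (0 : ℝ))).prod (volume.restrict (Ioi (0 : ℝ))),
      p.1 ≠ p.2 := by
    refine (Measure.ae_prod_iff_ae_ae (p := fun p : ℝ × ℝ => p.1 ≠ p.2)
      (measurableSet_eq_fun measurable_fst measurable_snd).compl).mpr ?_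
    refine ae_of_all _ fun l => ?_
    filter_upwards [(volume.restrict (Ioi (0 : ℝ))).ae_ne l] with m hm
    exact hm.symm
  refine integral_congr_ae ?_
  filter_upwards [hne] with p hp
  by_cases h0 : f p.1 * f p.2 = 0
  · simp [h0]
  · rw [integral_kernel (hα0.trans_le (hα _ (left_ne_zero_of_mul h0)))
      (hα0.trans_le (hα _ (right_ne_zero_of_mul h0))) hp]

theorem exists_pos_le_of_ne_zero {f : ℝ → ℝ} (hfs : HasCompactSupport f)
    (hfsupp : tsupport f ⊆ Ioi 0) : ∃ α, 0 < α ∧ ∀ l, f l ≠ 0 → α ≤ l := by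
  rcases (tsupport f).eq_empty_or_nonempty with h | h
  · refine ⟨1, one_pos, fun l hl => ?_⟩
    have := subset_tsupport f (Function.mem_support.mpr hl)
    simp [h] at this
  · obtain ⟨α, hα, hmin⟩ := IsCompact.exists_isLeast hfs h
    exact ⟨α, hfsupp hα, fun l hl => hmin (subset_tsupport f hl)⟩

theorem integral_sq_PiT {f : ℝ → ℝ} (hf : Continuous f) (hfs : HasCompactSupport f)
    (hfsupp : tsupport f ⊆ Ioi 0) :
    IntegrableOn (fun x => PiT f x ^ 2) (Ioi 0) ∧
    ∫ x in Ioi (0 : ℝ), PiT f x ^ 2 = π / 2 * ∫ l in Ioi (0 : ℝ), f l ^ 2 := by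
  obtain ⟨α, hα0, hα⟩ := exists_pos_le_of_ne_zero hfs hfsupp
  obtain ⟨i1, h1⟩ := integral_sq_sin hf hfs hα0 hα
  obtain ⟨i2, h2⟩ := integral_sq_sin_sub_sq_PiT
    (hf.integrable_of_hasCompactSupport hfs).integrableOn hα0 hα
  have i3 : IntegrableOn (fun x => PiT f x ^ 2) (Ioi 0) :=
    (i1.sub i2).congr (ae_of_all _ fun x => by simp)
  refine ⟨i3, ?_⟩
  rw [integral_sub i1 i3, h1] at h2
  linarith

theorem plancherel_PiT (f g : ℝ → ℝ)
    (hf : Continuous f) (hg : Continuous g)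
    (hfs : HasCompactSupport f) (hgs : HasCompactSupport g)
    (hfsupp : tsupport f ⊆ Ioi 0) (hgsupp : tsupport g ⊆ Ioi 0) :
    IntegrableOn (fun x => (PiT f x) ^ 2) (Ioi 0) ∧
    IntegrableOn (fun x => (PiT g x) ^ 2) (Ioi 0) ∧
    (∫ x in Ioi (0 : ℝ), PiT f x * PiT g x)
      = (Real.pi / 2) * ∫ l in Ioi (0 : ℝ), f l * g l := by
  obtain ⟨i1, h1⟩ := integral_sq_PiT hf hfs hfsupp
  obtain ⟨i2, h2⟩ := integral_sq_PiT hg hgs hgsupp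
  refine ⟨i1, i2, ?_⟩
  obtain ⟨h, hh⟩ : ∃ h : ℝ → ℝ, h = fun l => f l + g l := ⟨_, rfl⟩
  have hhc : Continuous h := hh ▸ hf.add hg
  have hhs : HasCompactSupport h := hh ▸ hfs.add hgs
  have hhsupp : tsupport h ⊆ Ioi 0 :=
    hh ▸ (tsupport_add f g).trans (union_subset hfsupp hgsupp)
  obtain ⟨i3, h3⟩ := integral_sq_PiT hhc hhs hhsupp
  have hfi : Integrable f := hf.integrable_of_hasCompactSupport hfs
  have hgi : Integrable g := hg.integrable_of_hasCompactSupport hgs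
  have e : ∀ x, PiT f x * PiT g x =
      1 / 2 * (PiT h x ^ 2 - PiT f x ^ 2 - PiT g x ^ 2) := fun x => by
    rw [hh, PiT_add hfi hgi x]
    ring
  have e' : ∀ l, f l * g l = 1 / 2 * (h l ^ 2 - f l ^ 2 - g l ^ 2) := fun l => by
    rw [hh]
    ring
  have hsq : ∀ u : ℝ → ℝ, Continuous u → HasCompactSupport u →
      IntegrableOn (fun l => u l ^ 2) (Ioi 0) := fun u hc hs => by
    have h2 : HasCompactSupport fun l => u l ^ 2 := by
      simp only [sq]
      exact hs.mul_left
    have h3 : Integrable fun l => u l ^ 2 := (hc.pow 2).integrable_of_hasCompactSupport h2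
    exact h3.integrableOn
  have j1 := hsq f hf hfs
  have j2 := hsq g hg hgs
  have j3 := hsq h hhc hhs
  simp only [e, e']
  have i4 : IntegrableOn (fun x => PiT h x ^ 2 - PiT f x ^ 2) (Ioi 0) := i3.sub i1
  have j4 : IntegrableOn (fun x => h x ^ 2 - f x ^ 2) (Ioi 0) := j3.sub j1
  rw [integral_const_mul, integral_const_mul, integral_sub i4 i2, integral_sub i3 i1,
    integral_sub j4 j2, integral_sub j3 j1, h1, h2, h3]
  ring
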